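/- arXiv:2410.07581 — 4 statements merged into one kernel-verified Lean document; each statement's English description precedes it below -/
import Mathlib

section
/- The chromatic symmetric function of the cycle C_n on n vertices satisfies X_{C_n} = Σ_{I ⊨ n} (i_1 − 1) w_I e_I, where w_I = i_1 (i_2 − 1) ⋯ (i_z − 1) for I = i_1 ⋯ i_z. -/
open scoped Classical
open MvPolynomial Finset

noncomputable section

/-- `σ⁺_I(a)`: the minimal partial sum of `I` that is at least `a`. -/
def sigmaP (I : List ℕ) (a : ℝ) : ℝ :=
  sInf {x : ℝ | ∃ k ≤ I.length, x = ((I.take k).sum : ℝ) ∧ a ≤ x}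

/-- `Θ⁺_I(a) = σ⁺_I(a) − a`. -/
def thetaP (I : List ℕ) (a : ℝ) : ℝ := sigmaP I a - a

/-- `σ⁻_I(a)`: the maximal partial sum of `I` that is at most `a`. -/
def sigmaM (I : List ℕ) (a : ℝ) : ℝ :=
  sSup {x : ℝ | ∃ k ≤ I.length, x = ((I.take k).sum : ℝ) ∧ x ≤ a}

/-- `Θ⁻_I(a) = a − σ⁻_I(a)`. -/
def thetaM (I : List ℕ) (a : ℝ) : ℝ := a - sigmaM I a

/-- `w_I = i₁(i₂−1)⋯(i_z−1)`. -/
def wI : List ℕ → ℕ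
  | [] => 1
  | i :: t => i * (t.map (· - 1)).prod

/-- `e_I`: the product of elementary symmetric polynomials indexed by the parts of `I`,
in `N` variables. -/
def eComp (N : ℕ) (I : List ℕ) : MvPolynomial (Fin N) ℝ :=
  (I.map fun i => MvPolynomial.esymm (Fin N) ℝ i).prod

/-- The chromatic symmetric function of a graph, truncated to `N` variables. -/
def csf {V : Type} [Fintype V] (G : SimpleGraph V) (N : ℕ) : MvPolynomial (Fin N) ℝ :=
  ∑ κ : V → Fin N,
    if ∀ u v, G.Adj u v → κ u ≠ κ v then ∏ v, MvPolynomial.X (κ v) else 0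

/-- Add a single edge `uv` to a graph. -/
def addE {V : Type} (G : SimpleGraph V) (u v : V) : SimpleGraph V :=
  G ⊔ SimpleGraph.fromRel fun x y => x = u ∧ y = v

/-- The list of consecutive pairs of a list of vertices. -/
def chainE (l : List ℕ) : List (ℕ × ℕ) := l.zip l.tail

/-- The simple graph on `Fin n` with the given list of edges. -/
def graphOfEdges (n : ℕ) (E : List (ℕ × ℕ)) : SimpleGraph (Fin n) :=
  SimpleGraph.fromRel fun u v => ((u : ℕ), (v : ℕ)) ∈ E

/-- The path on `n` vertices. -/
def pathG (n : ℕ) : SimpleGraph (Fin n) := graphOfEdges n (chainE (List.range n))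

/-- The cycle on `n` vertices. -/
def cycleG (n : ℕ) : SimpleGraph (Fin n) :=
  graphOfEdges n (chainE (List.range n ++ [0]))

/-- The tadpole `C_a^l`: a cycle on `a` vertices with a path of `l` edges attached. -/
def tadpoleG (a l : ℕ) : SimpleGraph (Fin (a + l)) :=
  graphOfEdges (a + l)
    (chainE (List.range a ++ [0]) ++ chainE (0 :: (List.range l).map (· + a)))

/-- The theta graph `θ_{abc}`: two vertices (`0` and `a+b+c-2`) joined by three internally
disjoint paths of lengths `a`, `b`, `c`. -/
def thetaG (a b c : ℕ) : SimpleGraph (Fin (a + b + c - 1)) :=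
  graphOfEdges (a + b + c - 1)
    (chainE (0 :: ((List.range (a - 1)).map (· + 1) ++ [a + b + c - 2])) ++
     chainE (0 :: ((List.range (b - 1)).map (· + a) ++ [a + b + c - 2])) ++
     chainE (0 :: ((List.range (c - 1)).map (· + (a + b - 1)) ++ [a + b + c - 2])))

/-- The index `p` defined by `m = i₁ + ⋯ + i_{p-1} + s` with `1 ≤ s ≤ i_p`:
the least `k` with `i₁ + ⋯ + i_k ≥ m`. -/
def pIdx (I : List ℕ) (m : ℕ) : ℕ := sInf {k | m ≤ (I.take k).sum}

/-- The number `s` defined by `m = i₁ + ⋯ + i_{p-1} + s` with `1 ≤ s ≤ i_p`. -/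
def sVal (I : List ℕ) (m : ℕ) : ℕ := m - (I.take (pIdx I m - 1)).sum

/-- The index `q` defined by `m = i₂ + ⋯ + i_q + t` with `1 ≤ t ≤ i_{q+1}`
(convention `i_{z+1} = i₁`). -/
def qIdx (I : List ℕ) (m : ℕ) : ℕ := sInf {k | m ≤ ((I.tail ++ I.take 1).take k).sum}

/-- The number `t` defined by `m = i₂ + ⋯ + i_q + t` with `1 ≤ t ≤ i_{q+1}`. -/
def tVal (I : List ℕ) (m : ℕ) : ℕ := m - ((I.tail ++ I.take 1).take (qIdx I m - 1)).sum

/-- The part `i_p`. -/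
def ipPart (I : List ℕ) (m : ℕ) : ℕ := I.getD (pIdx I m - 1) 0

/-- The second elementary symmetric polynomial evaluated on a list. -/
def e2 : List ℕ → ℤ
  | [] => 0
  | x :: t => (x : ℤ) * t.sum + e2 t

/-- The cycle-chord coefficient `Δ_I(m)`. -/
def DeltaI (I : List ℕ) (m : ℕ) : ℤ :=
  if (I.headI : ℤ) ≤ (ipPart I m : ℤ) - sVal I m then
    (sVal I m : ℤ) * ((ipPart I m : ℤ) - sVal I m - I.headI)
  else
    e2 ((ipPart I m - sVal I m) ::
        ((I.drop (pIdx I m)).take (qIdx I m - pIdx I m) ++ [tVal I m]))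

/-- The length of the prefix `P` in the decomposition `I = PQ`, where `Q` is the shortest
suffix of `I` with `|Q| ≥ a`. -/
def kPhi (a : ℕ) (I : List ℕ) : ℕ := sSup {j | j ≤ I.length ∧ a ≤ (I.drop j).sum}

/-- The transformation `φ`: writing `I = PQ` with `Q` the shortest suffix of modulus `≥ a`,
`φ(I) = I` if `Q = I`, and otherwise `φ(I) = i₁ · reverse(P∖i₁) · Q`. -/
def phi (a : ℕ) (I : List ℕ) : List ℕ :=
  if kPhi a I = 0 then I
  else I.take 1 ++ ((I.drop 1).take (kPhi a I - 1)).reverse ++ I.drop (kPhi a I)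

/-- The starting position of the longest suffix `R_I` of `I` of modulus `≤ a`. -/
def rIdx (a : ℕ) (I : List ℕ) : ℕ := sInf {j | (I.drop j).sum ≤ a}

/-- The partial reversal `ψ(I) = reverse(L_I) R_I`, where `R_I` is the longest suffix of `I`
of modulus `≤ a` and `L_I` is the complementary prefix. -/
def psi (a : ℕ) (I : List ℕ) : List ℕ :=
  (I.take (rIdx a I)).reverse ++ I.drop (rIdx a I)

/-- The clock coefficient `D_I = Θ⁺_I(2) − Θ⁻_{reverse(φ(I))}(a) + Δ_I(b+1)`. -/
def DI (a b : ℕ) (I : List ℕ) : ℝ :=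
  thetaP I 2 - thetaM (phi a I).reverse a + (DeltaI I (b + 1) : ℝ)

end

noncomputable section GeneratingFunctions

variable {ι R : Type*} [CommRing R]

/-- The weighted adjacency matrix of the complete graph: `x j` off the diagonal, `0` on it. -/
def offDiagMatrix [DecidableEq ι] (x : ι → R) : Matrix ι ι R :=
  Matrix.of fun i j => if i = j then 0 else x j

theorem prod_one_add_C_mul_X_eq_mk [Fintype ι] (x : ι → R) :
    ∏ i, (1 + PowerSeries.C (x i) * PowerSeries.X)
      = PowerSeries.mk fun k => ∑ s ∈ powersetCard k (univ : Finset ι), ∏ i ∈ s, x i := by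
  ext k
  rw [Finset.prod_one_add, map_sum, PowerSeries.coeff_mk, powersetCard_eq_filter,
    Finset.sum_filter]
  refine Finset.sum_congr rfl fun s _ => ?_
  rw [Finset.prod_mul_distrib, Finset.prod_const, ← map_prod, PowerSeries.coeff_C_mul,
    PowerSeries.coeff_X_pow]
  simp [eq_comm]

theorem exists_inverse_one_add_C_mul_X (a : R) :
    ∃ b : PowerSeries R, b * (1 + PowerSeries.C a * PowerSeries.X) = 1 := by
  have h : IsUnit (1 + PowerSeries.C a * PowerSeries.X) := by
    rw [PowerSeries.isUnit_iff_constantCoeff]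
    simp
  exact h.exists_left_inv

theorem derivative_prod_one_add_C_mul_X [DecidableEq ι] (x : ι → R) (b : ι → PowerSeries R)
    (hb : ∀ i, b i * (1 + PowerSeries.C (x i) * PowerSeries.X) = 1) (s : Finset ι) :
    PowerSeries.derivative R (∏ i ∈ s, (1 + PowerSeries.C (x i) * PowerSeries.X))
      = (∏ i ∈ s, (1 + PowerSeries.C (x i) * PowerSeries.X))
        * ∑ i ∈ s, PowerSeries.C (x i) * b i := by
  induction s using Finset.induction_on with
  | empty => simp
  | insert a s ha ih =>
    rw [Finset.prod_insert ha, Finset.sum_insert ha, Derivation.leibniz, ih]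
    simp only [smul_eq_mul, map_add, Derivation.leibniz, PowerSeries.derivative_C,
      PowerSeries.derivative_X, PowerSeries.derivative_one]
    linear_combination (-(∏ i ∈ s, (1 + PowerSeries.C (x i) * PowerSeries.X))
      * PowerSeries.C (x a)) * hb a

theorem derivative_inverse_one_add_C_mul_X (a : R) (b : PowerSeries R)
    (hb : b * (1 + PowerSeries.C a * PowerSeries.X) = 1) :
    PowerSeries.derivative R b = -(PowerSeries.C a * b ^ 2) := by
  have h := congrArg (PowerSeries.derivative R) hb
  simp only [smul_eq_mul, map_add, Derivation.leibniz, PowerSeries.derivative_C,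
    PowerSeries.derivative_X, PowerSeries.derivative_one] at h
  linear_combination b * h - PowerSeries.derivative R b * hb

variable [Fintype ι] [DecidableEq ι]

/-- The generating function of the entries of the powers of `offDiagMatrix x`. -/
def walkSeries (x : ι → R) (i j : ι) : PowerSeries R :=
  PowerSeries.mk fun n => (offDiagMatrix x ^ n) i j

theorem walkSeries_mul (x : ι → R) (i j : ι) :
    walkSeries x i j * (1 + PowerSeries.C (x j) * PowerSeries.X)
      = (if i = j then 1 else 0)
        + PowerSeries.C (x j) * PowerSeries.X * ∑ l, walkSeries x i l := by
  suffices h : walkSeries x i j = (if i = j then 1 else 0)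
      + PowerSeries.X * (PowerSeries.C (x j) * (∑ l, walkSeries x i l - walkSeries x i j)) by
    linear_combination h
  ext n
  cases n with
  | zero =>
    simp only [walkSeries, map_add, PowerSeries.coeff_mk, pow_zero, Matrix.one_apply,
      PowerSeries.coeff_zero_X_mul]
    split_ifs <;> simp
  | succ n =>
    rw [map_add, PowerSeries.coeff_succ_X_mul, PowerSeries.coeff_C_mul, map_sub, map_sum]
    have h0 : PowerSeries.coeff (n + 1) (if i = j then (1 : PowerSeries R) else 0) = 0 := by
      split_ifs <;> simp [PowerSeries.coeff_one]
    simp only [h0, walkSeries, PowerSeries.coeff_mk, pow_succ, Matrix.mul_apply]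
    have h1 : ∀ l, (offDiagMatrix x ^ n) i l * offDiagMatrix x l j
        = x j * (offDiagMatrix x ^ n) i l
          - if l = j then x j * (offDiagMatrix x ^ n) i l else 0 := by
      intro l
      simp only [offDiagMatrix, Matrix.of_apply]
      split_ifs <;> ring
    simp [h1, Finset.sum_sub_distrib, mul_sub, Finset.mul_sum]

theorem trace_walkSeries_mul (x : ι → R) (E : PowerSeries R)
    (hE : E = ∏ i, (1 + PowerSeries.C (x i) * PowerSeries.X)) :
    (∑ i, walkSeries x i i - PowerSeries.C (Fintype.card ι : R))
        * (E - PowerSeries.X * PowerSeries.derivative R E)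
      = PowerSeries.X ^ 2 * PowerSeries.derivative R (PowerSeries.derivative R E) := by
  choose b hb using fun i => exists_inverse_one_add_C_mul_X (x i)
  have hE' : PowerSeries.derivative R E = E * ∑ i, PowerSeries.C (x i) * b i := by
    rw [hE]
    exact derivative_prod_one_add_C_mul_X x b hb univ
  set S := ∑ i, PowerSeries.C (x i) * b i with hS
  set Q := ∑ i, (PowerSeries.C (x i) * b i) ^ 2 with hQ
  have hS' : PowerSeries.derivative R S = -Q := by
    rw [hS, hQ, map_sum, ← Finset.sum_neg_distrib]
    refine Finset.sum_congr rfl fun i _ => ?_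
    rw [Derivation.leibniz, PowerSeries.derivative_C,
      derivative_inverse_one_add_C_mul_X _ _ (hb i)]
    simp only [smul_eq_mul]
    ring
  have hE'' : PowerSeries.derivative R (PowerSeries.derivative R E) = E * (S ^ 2 - Q) := by
    rw [hE', Derivation.leibniz, hE', hS']
    simp only [smul_eq_mul]
    ring
  have hwalk : ∀ i j, walkSeries x i j = (if i = j then b j else 0)
      + PowerSeries.X * (PowerSeries.C (x j) * b j) * ∑ l, walkSeries x i l := by
    intro i j
    have h := walkSeries_mul x i j
    have hif : (if i = j then b j else 0) = b j * (if i = j then 1 else 0) := by simp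
    rw [hif]
    linear_combination b j * h - walkSeries x i j * hb j
  have hrow : ∀ i, (∑ l, walkSeries x i l) * (1 - PowerSeries.X * S) = b i := by
    intro i
    have h : ∑ l, walkSeries x i l
        = b i + PowerSeries.X * S * ∑ l, walkSeries x i l := by
      conv_lhs => rw [Finset.sum_congr rfl fun j _ => hwalk i j]
      rw [Finset.sum_add_distrib, ← Finset.sum_mul, ← Finset.mul_sum]
      simp [hS]
    linear_combination h
  have hb1 : ∀ i, b i = 1 - PowerSeries.X * (PowerSeries.C (x i) * b i) := fun i => by
    linear_combination hb i
  have hbsum : ∑ i, b i = PowerSeries.C (Fintype.card ι : R) - PowerSeries.X * S := by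
    rw [Finset.sum_congr rfl fun i _ => hb1 i, Finset.sum_sub_distrib, ← Finset.mul_sum]
    simp [hS]
  have hdiag : ∀ i, walkSeries x i i * (1 - PowerSeries.X * S)
      = b i * (1 - PowerSeries.X * S) + PowerSeries.X * (PowerSeries.C (x i) * b i)
        - PowerSeries.X ^ 2 * (PowerSeries.C (x i) * b i) ^ 2 := by
    intro i
    have h := hwalk i i
    rw [if_pos rfl] at h
    linear_combination (1 - PowerSeries.X * S) * h
      + PowerSeries.X * (PowerSeries.C (x i) * b i) * hrow i
      + PowerSeries.X * (PowerSeries.C (x i) * b i) * hb1 i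
  have htrace : (∑ i, walkSeries x i i) * (1 - PowerSeries.X * S)
      = (∑ i, b i) * (1 - PowerSeries.X * S) + PowerSeries.X * S
        - PowerSeries.X ^ 2 * Q := by
    rw [Finset.sum_mul, Finset.sum_congr rfl fun i _ => hdiag i, Finset.sum_sub_distrib,
      Finset.sum_add_distrib, ← Finset.sum_mul, ← Finset.mul_sum, ← Finset.mul_sum]
  rw [hE'', hE']
  rw [hbsum] at htrace
  linear_combination E * htrace

theorem sum_prod_offDiagMatrix (x : ι → R) (k : ℕ) (h : ι → ι → R) :
    ∑ κ : Fin (k + 1) → ι,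
        (∏ v : Fin k, offDiagMatrix x (κ v.castSucc) (κ v.succ)) * h (κ 0) (κ (Fin.last k))
      = ∑ i, ∑ j, (offDiagMatrix x ^ k) i j * h i j := by
  induction k generalizing h with
  | zero =>
    rw [← (Equiv.funUnique (Fin 1) ι).symm.sum_comp]
    simp [Matrix.one_apply]
  | succ k ih =>
    rw [← (Fin.snocEquiv fun _ => ι).sum_comp, Fintype.sum_prod_type, Finset.sum_comm]
    have hl := ih fun i l => ∑ j, offDiagMatrix x l j * h i j
    rw [← Finset.sum_congr rfl fun κ _ => ?_] at hl
    rotate_left 1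
    · exact fun κ => ∑ j : ι, (∏ v : Fin (k + 1),
        offDiagMatrix x (Fin.snoc (α := fun _ => ι) κ j v.castSucc)
          (Fin.snoc (α := fun _ => ι) κ j v.succ)) * h (κ 0) j
    · rw [Finset.mul_sum]
      refine Finset.sum_congr rfl fun j _ => ?_
      rw [Fin.prod_univ_castSucc]
      simp only [Fin.snoc_castSucc, Fin.succ_last, Fin.snoc_last, ← Fin.castSucc_succ]
      ring
    · refine (Finset.sum_congr rfl fun κ _ => Finset.sum_congr rfl fun j _ => ?_).trans
        (hl.trans ?_)
      · simp only [Fin.snocEquiv, Equiv.coe_fn_mk, Fin.snoc_last]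
        rw [show (0 : Fin (k + 1 + 1)) = Fin.castSucc 0 from rfl, Fin.snoc_castSucc]
      · refine Finset.sum_congr rfl fun i _ => ?_
        simp only [pow_succ, Matrix.mul_apply, Finset.mul_sum, Finset.sum_mul, mul_assoc]
        rw [Finset.sum_comm]

end GeneratingFunctions

section Compositions

variable {R : Type*} [CommRing R]

theorem sum_composition_succ {M : Type*} [AddCommMonoid M] (m : ℕ) (g : List ℕ → M) :
    ∑ I : Composition (m + 1), g I.blocks
      = ∑ p ∈ antidiagonal m, ∑ J : Composition p.2, g ((p.1 + 1) :: J.blocks) := by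
  rw [Finset.sum_sigma']
  symm
  refine Finset.sum_bij
    (fun q hq => ⟨(q.1.1 + 1) :: q.2.blocks, ?_, ?_⟩) ?_ ?_ ?_ ?_
  · intro i hi
    rcases List.mem_cons.1 hi with rfl | hi
    · omega
    · exact q.2.blocks_pos hi
  · have h := Finset.HasAntidiagonal.mem_antidiagonal.1 (Finset.mem_sigma.1 hq).1
    rw [List.sum_cons, q.2.blocks_sum]
    omega
  · simp
  · rintro ⟨⟨a, b⟩, J⟩ _ ⟨⟨a', b'⟩, J'⟩ _ h
    have hblocks := congrArg Composition.blocks h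
    simp only [List.cons.injEq, add_left_inj] at hblocks
    obtain ⟨rfl, hJ⟩ := hblocks
    obtain rfl : b = b' := J.blocks_sum.symm.trans ((congrArg List.sum hJ).trans J'.blocks_sum)
    obtain rfl : J = J' := Composition.ext hJ
    rfl
  · rintro ⟨blocks, hpos, hsum⟩ _
    cases blocks with
    | nil => simp at hsum
    | cons a t =>
      have ha : 0 < a := hpos (by simp)
      rw [List.sum_cons] at hsum
      refine ⟨⟨(a - 1, t.sum), ⟨t, fun hi => hpos (List.mem_cons_of_mem _ hi), rfl⟩⟩, ?_, ?_⟩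
      · simp only [mem_sigma, HasAntidiagonal.mem_antidiagonal, mem_univ, and_true]
        omega
      · apply Composition.ext
        simp only [List.cons.injEq, and_true]
        omega
  · intros
    rfl

theorem mk_sum_composition_mul (v : ℕ → R) (hv : v 0 = 0) :
    (PowerSeries.mk fun n => ∑ J : Composition n, (J.blocks.map v).prod)
      * (1 - PowerSeries.mk v) = 1 := by
  suffices h : (PowerSeries.mk fun n => ∑ J : Composition n, (J.blocks.map v).prod)
      = 1 + PowerSeries.mk v
        * (PowerSeries.mk fun n => ∑ J : Composition n, (J.blocks.map v).prod) by
    linear_combination h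
  ext n
  rw [map_add, PowerSeries.coeff_mul]
  simp only [PowerSeries.coeff_mk, PowerSeries.coeff_one]
  cases n with
  | zero =>
    have hnil : ∀ J : Composition 0, J.blocks = [] := fun J =>
      List.eq_nil_iff_forall_not_mem.2 fun i hi => by
        have h1 := J.blocks_pos hi
        have h2 := List.single_le_sum (fun _ _ => Nat.zero_le _) i hi
        rw [J.blocks_sum] at h2
        omega
    simp [hv, hnil, composition_card]
  | succ m =>
    rw [sum_composition_succ m fun l => (l.map v).prod, Finset.Nat.antidiagonal_succ]
    simp [hv, Finset.mul_sum]
    rfl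

theorem sum_composition_head_tail (u v : ℕ → R) (hu : u 0 = 0) (m : ℕ) :
    PowerSeries.coeff (m + 1) (PowerSeries.mk u
        * (PowerSeries.mk fun n => ∑ J : Composition n, (J.blocks.map v).prod))
      = ∑ I : Composition (m + 1), u I.blocks.headI * (I.blocks.tail.map v).prod := by
  rw [PowerSeries.coeff_mul, Finset.Nat.antidiagonal_succ,
    sum_composition_succ m fun l => u l.headI * (l.tail.map v).prod]
  simp [hu, Finset.mul_sum]
  rfl

end Compositions

/-- The trace of a power of `offDiagMatrix x` as a sum over compositions. -/
theorem trace_offDiagMatrix_pow {ι R : Type*} [Fintype ι] [DecidableEq ι] [CommRing R]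
    (x : ι → R) (e : ℕ → R)
    (he : ∀ k, e k = ∑ s ∈ powersetCard k (univ : Finset ι), ∏ i ∈ s, x i) (m : ℕ) :
    (offDiagMatrix x ^ (m + 1)).trace
      = ∑ I : Composition (m + 1),
          (((I.blocks.headI - 1) * I.blocks.headI : ℕ) : R) * e I.blocks.headI
            * (I.blocks.tail.map fun k => ((k - 1 : ℕ) : R) * e k).prod := by
  set E : PowerSeries R := PowerSeries.mk e with hE
  set u : ℕ → R := fun k => (((k - 1) * k : ℕ) : R) * e k with hu
  set v : ℕ → R := fun k => ((k - 1 : ℕ) : R) * e k with hv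
  have hprod : E = ∏ i, (1 + PowerSeries.C (x i) * PowerSeries.X) := by
    rw [prod_one_add_C_mul_X_eq_mk, hE, funext he]
  have hU : E - PowerSeries.X * PowerSeries.derivative R E = 1 - PowerSeries.mk v := by
    ext n
    cases n with
    | zero => simp [hE, hv, he]
    | succ n =>
      simp [hE, hv, PowerSeries.coeff_succ_X_mul, PowerSeries.coeff_derivative,
        PowerSeries.coeff_one]
      ring
  have hW : PowerSeries.X ^ 2 * PowerSeries.derivative R (PowerSeries.derivative R E)
      = PowerSeries.mk u := by
    ext n
    rcases n with _ | _ | n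
    · simp [hu]
    · simp [hu, PowerSeries.coeff_X_pow_mul']
    · rw [add_assoc, one_add_one_eq_two, PowerSeries.coeff_X_pow_mul]
      simp [hE, hu, PowerSeries.coeff_derivative]
      rw [add_assoc n 1 1, one_add_one_eq_two]
      ring
  have h := trace_walkSeries_mul x E hprod
  rw [hU, hW] at h
  have hB := mk_sum_composition_mul v (by simp [hv])
  set B := PowerSeries.mk fun n => ∑ J : Composition n, (J.blocks.map v).prod
  have hT : ∑ i, walkSeries x i i = PowerSeries.C (Fintype.card ι : R)
      + PowerSeries.mk u * B := by
    linear_combination B * h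
      - (∑ i, walkSeries x i i - PowerSeries.C (Fintype.card ι : R)) * hB
  have hc := congrArg (PowerSeries.coeff (m + 1)) hT
  rw [map_add, sum_composition_head_tail u v (by simp [hu]), PowerSeries.coeff_C,
    if_neg (Nat.succ_ne_zero m), zero_add, map_sum] at hc
  simpa [walkSeries, Matrix.trace, hu] using hc

theorem mem_chainE_range_append_zero (k a b : ℕ) :
    (a, b) ∈ chainE (List.range (k + 1) ++ [0])
      ↔ (a < k ∧ b = a + 1) ∨ (a = k ∧ b = 0) := by
  have hlen : (chainE (List.range (k + 1) ++ [0])).length = k + 1 := by simp [chainE]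
  have hget : ∀ i (hi : i < (chainE (List.range (k + 1) ++ [0])).length),
      (chainE (List.range (k + 1) ++ [0]))[i] = (i, if i < k then i + 1 else 0) := by
    intro i hi
    have hi' : i < k + 1 := hlen ▸ hi
    simp only [chainE, List.getElem_zip, List.getElem_tail, List.getElem_append,
      List.length_range, List.getElem_range, hi', dif_pos]
    by_cases h : i < k
    · simp [h]
    · simp [h]
  rw [List.mem_iff_getElem]
  constructor
  · rintro ⟨i, hi, h⟩
    rw [hget] at h
    rw [hlen] at hi
    simp only [Prod.mk.injEq] at h
    split_ifs at h <;> omega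
  · intro h
    refine ⟨a, by omega, ?_⟩
    rw [hget]
    simp only [Prod.mk.injEq, true_and]
    split_ifs <;> omega

theorem proper_cycleG_iff {α : Type*} (k : ℕ) (hk : 1 ≤ k) (κ : Fin (k + 1) → α) :
    (∀ u v, (cycleG (k + 1)).Adj u v → κ u ≠ κ v)
      ↔ (∀ v : Fin k, κ v.castSucc ≠ κ v.succ) ∧ κ (Fin.last k) ≠ κ 0 := by
  simp only [cycleG, graphOfEdges, SimpleGraph.fromRel_adj, mem_chainE_range_append_zero]
  constructor
  · refine fun h => ⟨fun v => h _ _ ⟨?_, Or.inl (Or.inl ?_)⟩,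
      h _ _ ⟨?_, Or.inl (Or.inr ?_)⟩⟩
    · simp [Fin.ext_iff]
    · simp
    · simp only [ne_eq, Fin.ext_iff, Fin.val_last, Fin.val_zero]
      omega
    · simp
  · rintro ⟨hstep, hlast⟩
    have key : ∀ u v : Fin (k + 1),
        (((u : ℕ) < k ∧ (v : ℕ) = u + 1) ∨ ((u : ℕ) = k ∧ (v : ℕ) = 0)) → κ u ≠ κ v := by
      rintro u v (⟨h1, h2⟩ | ⟨h1, h2⟩)
      · obtain rfl : v = Fin.succ ⟨u, h1⟩ := Fin.ext h2
        exact hstep ⟨u, h1⟩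
      · obtain rfl : u = Fin.last k := Fin.ext h1
        obtain rfl : v = 0 := Fin.ext h2
        exact hlast
    rintro u v ⟨_, h | h⟩
    · exact key u v h
    · exact (key v u h).symm

theorem csf_cycleG_eq_trace (k : ℕ) (hk : 1 ≤ k) (N : ℕ) :
    csf (cycleG (k + 1)) N
      = (offDiagMatrix (fun i : Fin N => (MvPolynomial.X i : MvPolynomial (Fin N) ℝ))
          ^ (k + 1)).trace := by
  set x : Fin N → MvPolynomial (Fin N) ℝ := fun i => MvPolynomial.X i with hx
  have hM : ∀ i j, offDiagMatrix x i j = if i ≠ j then x j else 0 := fun i j => by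
    simp [offDiagMatrix]
  have h := sum_prod_offDiagMatrix x k fun i j => offDiagMatrix x j i
  have htr : (offDiagMatrix x ^ (k + 1)).trace
      = ∑ i, ∑ j, (offDiagMatrix x ^ k) i j * offDiagMatrix x j i := by
    simp [Matrix.trace, pow_succ, Matrix.mul_apply]
  rw [htr, ← h, csf]
  refine Finset.sum_congr (by ext; simp) fun κ _ => ?_
  simp only [hM, proper_cycleG_iff k hk]
  by_cases hstep : ∀ v : Fin k, κ v.castSucc ≠ κ v.succ
  · by_cases hlast : κ (Fin.last k) ≠ κ 0
    · rw [if_pos ⟨hstep, hlast⟩, if_pos hlast, Fin.prod_univ_succ, mul_comm]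
      congr 1
      exact Finset.prod_congr rfl fun v _ => (if_pos (hstep v)).symm
    · rw [if_neg fun h => hlast h.2, if_neg hlast, mul_zero]
  · rw [if_neg fun h => hstep h.1]
    push Not at hstep
    obtain ⟨v, hv⟩ := hstep
    rw [Finset.prod_eq_zero (mem_univ v) (by simp [hv]), zero_mul]

theorem C_mul_wI_mul_eComp_cons (N a : ℕ) (t : List ℕ) :
    MvPolynomial.C (((a - 1) * wI (a :: t) : ℕ) : ℝ) * eComp N (a :: t)
      = (((a - 1) * a : ℕ) : MvPolynomial (Fin N) ℝ) * MvPolynomial.esymm (Fin N) ℝ a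
        * (t.map fun k => ((k - 1 : ℕ) : MvPolynomial (Fin N) ℝ)
            * MvPolynomial.esymm (Fin N) ℝ k).prod := by
  rw [List.prod_map_mul, map_natCast]
  simp only [wI, eComp, List.map_cons, List.prod_cons, Nat.cast_mul, Nat.cast_list_prod,
    List.map_map, Function.comp_def]
  ring

/-- `X_{C_n} = Σ_{I ⊨ n} (i₁ − 1) w_I e_I`. -/
theorem stmt3 (n : ℕ) (hn : 3 ≤ n) (N : ℕ) :
    csf (cycleG n) N
      = ∑ I : Composition n,
          MvPolynomial.C (((I.blocks.headI - 1) * wI I.blocks : ℕ) : ℝ)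
            * eComp N I.blocks := by
  obtain ⟨k, rfl⟩ : ∃ k, n = k + 1 := ⟨n - 1, by omega⟩
  rw [csf_cycleG_eq_trace k (by omega) N,
    trace_offDiagMatrix_pow _ (fun k => MvPolynomial.esymm (Fin N) ℝ k) fun _ => rfl]
  refine Finset.sum_congr rfl fun I _ => ?_
  obtain ⟨a, t, hI⟩ := List.exists_cons_of_ne_nil (l := I.blocks) fun h => by
    have hsum := I.blocks_sum
    simp [h] at hsum
  rw [hI]
  exact (C_mul_wI_mul_eComp_cons N a t).symm
end

section
/- For any 0 ≤ l ≤ n − 2, the chromatic symmetric function of the tadpole graph C_{n−l}^l satisfies X_{C_{n−l}^l} = Σ_{I ⊨ n} Θ⁺_I(l+1) w_I e_I. -/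
open scoped Classical
open MvPolynomial Finset

/-! ### Proper walks in the complete graph of colours -/

section Walks

variable {N : ℕ}

/-- The weighted sum of all proper sequences of `l` colours that may follow the colour `c`,
the last colour (or `c` itself, if `l = 0`) being weighted by `h`. -/
noncomputable def walkSum (h : Fin N → MvPolynomial (Fin N) ℝ) :
    ℕ → Fin N → MvPolynomial (Fin N) ℝ
  | 0, c => h c
  | l + 1, c => ∑ d, if d ≠ c then X d * walkSum h l d else 0

/-- The weighted sum of all proper sequences of `m` colours that may follow `c`. -/
noncomputable abbrev openSum (N : ℕ) : ℕ → Fin N → MvPolynomial (Fin N) ℝ :=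
  walkSum fun _ => 1

/-- The weighted sum of the proper sequences of `m` colours that may both follow and precede `c`. -/
noncomputable def closedSum (N m : ℕ) (c : Fin N) : MvPolynomial (Fin N) ℝ :=
  walkSum (fun d => if d ≠ c then 1 else 0) m c

/-- The chromatic symmetric function of the path on `m` vertices. -/
noncomputable def pathSum (N : ℕ) : ℕ → MvPolynomial (Fin N) ℝ
  | 0 => 1
  | m + 1 => ∑ c, X c * openSum N m c

theorem openSum_succ (m : ℕ) (c : Fin N) :
    openSum N (m + 1) c = pathSum N (m + 1) - X c * openSum N m c := by
  simp only [openSum, walkSum, pathSum]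
  rw [← Finset.add_sum_erase _ (fun d => X d * walkSum (fun _ => 1) m d) (mem_univ c),
    add_sub_cancel_left, ← Finset.sum_filter, Finset.filter_ne']

theorem walkSum_ne_succ (m : ℕ) (c d : Fin N) :
    walkSum (fun e => if e ≠ d then 1 else 0) (m + 1) c
      = openSum N (m + 1) c - X d * walkSum (fun e => if e ≠ d then 1 else 0) m c := by
  induction m generalizing c with
  | zero =>
    simp only [walkSum, openSum]
    rw [eq_comm, sub_eq_iff_eq_add, ← sub_eq_iff_eq_add', ← Finset.sum_sub_distrib,
      Finset.sum_eq_single d]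
    · rcases eq_or_ne c d with rfl | h
      · simp
      · simp [h, h.symm]
    · intro b _ hb; simp [hb]
    · simp
  | succ m ih =>
    have hw (h : Fin N → MvPolynomial (Fin N) ℝ) (k : ℕ) :
        walkSum h (k + 1) c = ∑ e, if e ≠ c then X e * walkSum h k e else 0 := rfl
    rw [openSum, hw, hw _ (m + 1), hw _ m, Finset.mul_sum, ← Finset.sum_sub_distrib]
    refine Finset.sum_congr rfl fun e _ => ?_
    rw [ih]
    split_ifs <;> ring

theorem closedSum_zero (c : Fin N) : closedSum N 0 c = 0 := by
  simp [closedSum, walkSum]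

theorem closedSum_succ (m : ℕ) (c : Fin N) :
    closedSum N (m + 1) c = openSum N (m + 1) c - X c * closedSum N m c :=
  walkSum_ne_succ m c c

theorem sum_X_mul_openSum_mul_openSum (m l : ℕ) :
    ∑ c, X c * openSum N m c * openSum N l c = pathSum N (m + 1 + l) := by
  induction l generalizing m with
  | zero => simp [openSum, walkSum, pathSum]
  | succ l ih =>
    have hsum (k : ℕ) : ∑ c, openSum N (k + 1) c = N * pathSum N (k + 1) - pathSum N (k + 1) := by
      simp only [openSum_succ, Finset.sum_sub_distrib]
      simp [pathSum]
    have key (c : Fin N) : X c * openSum N m c * openSum N (l + 1) c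
        = X c * openSum N (m + 1) c * openSum N l c
          + (pathSum N (m + 1) * openSum N (l + 1) c
            - pathSum N (l + 1) * openSum N (m + 1) c) := by
      rw [openSum_succ, openSum_succ]; ring
    simp_rw [key]
    rw [Finset.sum_add_distrib, ih, Finset.sum_sub_distrib, ← Finset.mul_sum, ← Finset.mul_sum,
      hsum, hsum, show m + 1 + 1 + l = m + 1 + (l + 1) by ring]
    ring

/-- The chromatic symmetric function of the tadpole `C_{m+1}^l`, as a sum over the colour of the
vertex of degree three. -/
noncomputable def tadpoleSum (N m l : ℕ) : MvPolynomial (Fin N) ℝ :=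
  ∑ c, X c * closedSum N m c * openSum N l c

theorem tadpoleSum_zero (l : ℕ) : tadpoleSum N 0 l = 0 := by
  simp [tadpoleSum, closedSum_zero]

theorem tadpoleSum_succ (m l : ℕ) :
    tadpoleSum N (m + 1) l
      = pathSum N (m + 1 + 1 + l) - pathSum N (l + 1) * tadpoleSum N m 0
        + tadpoleSum N m (l + 1) := by
  rw [← sum_X_mul_openSum_mul_openSum]
  simp only [tadpoleSum, Finset.mul_sum, ← Finset.sum_sub_distrib, ← Finset.sum_add_distrib]
  refine Finset.sum_congr rfl fun c _ => ?_
  rw [closedSum_succ, openSum_succ l, openSum, walkSum]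
  ring

end Walks

/-! ### The chromatic symmetric function of a tadpole -/

theorem sum_proper_eq_walkSum {N : ℕ} (h : Fin N → MvPolynomial (Fin N) ℝ) (l : ℕ) (c : Fin N) :
    (∑ g : Fin l → Fin N,
      if ∀ i : Fin l, (Fin.cons c g : Fin (l + 1) → Fin N) i.castSucc ≠ g i then
        h ((Fin.cons c g : Fin (l + 1) → Fin N) (Fin.last l)) * ∏ i, X (g i) else 0)
      = walkSum h l c := by
  induction l generalizing c with
  | zero => simp [walkSum]
  | succ l ih =>
    rw [walkSum, ← (Fin.consEquiv fun _ => Fin N).sum_comp, Fintype.sum_prod_type]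
    refine Finset.sum_congr rfl fun d _ => ?_
    rw [← ih]
    split_ifs with hd
    · rw [Finset.mul_sum]
      refine Finset.sum_congr rfl fun g _ => ?_
      simp only [Fin.consEquiv, Equiv.coe_fn_mk, Fin.forall_fin_succ (n := l), Fin.castSucc_zero,
        Fin.cons_zero, ← Fin.succ_castSucc, Fin.cons_succ, Fin.prod_univ_succ, ← Fin.succ_last,
        hd.symm, ne_eq, not_false_eq_true, true_and, mul_ite, mul_zero]
      split_ifs <;> ring
    · refine Finset.sum_eq_zero fun g _ => if_neg fun H => hd ?_
      simpa [Fin.consEquiv, eq_comm] using H 0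

theorem mem_chainE {L : List ℕ} {u v : ℕ} :
    (u, v) ∈ chainE L ↔ ∃ i, L[i]? = some u ∧ L[i + 1]? = some v := by
  simp only [chainE, List.mem_iff_getElem?, List.getElem?_zip_eq_some, List.getElem?_tail]

theorem mem_cycle_chainE {m u v : ℕ} :
    (u, v) ∈ chainE (List.range (m + 1) ++ [0])
      ↔ (u < m ∧ v = u + 1) ∨ (u = m ∧ v = 0) := by
  rw [mem_chainE]
  constructor
  · rintro ⟨i, hi, hj⟩
    grind
  · rintro (⟨h, rfl⟩ | ⟨rfl, rfl⟩)
    · exact ⟨u, by grind, by grind⟩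
    · exact ⟨u, by grind, by grind⟩

theorem mem_tail_chainE {a l u v : ℕ} :
    (u, v) ∈ chainE (0 :: (List.range l).map (· + a))
      ↔ (u = 0 ∧ v = a ∧ 0 < l) ∨ (a ≤ u ∧ v = u + 1 ∧ v < a + l) := by
  rw [mem_chainE]
  constructor
  · rintro ⟨i, hi, hj⟩
    rcases i with _ | i <;> grind
  · rintro (⟨rfl, rfl, h⟩ | ⟨h, rfl, h'⟩)
    · exact ⟨0, by grind, by grind⟩
    · exact ⟨u - a + 1, by grind, by grind⟩

theorem proper_graphOfEdges_iff {α : Type*} {n : ℕ} {E : List (ℕ × ℕ)}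
    (hE : ∀ u, (u, u) ∉ E) (κ : Fin n → α) :
    (∀ u v, (graphOfEdges n E).Adj u v → κ u ≠ κ v)
      ↔ ∀ u v : Fin n, ((u : ℕ), (v : ℕ)) ∈ E → κ u ≠ κ v := by
  simp only [graphOfEdges, SimpleGraph.fromRel_adj]
  constructor
  · intro H u v huv
    refine H u v ⟨?_, Or.inl huv⟩
    rintro rfl
    exact hE _ huv
  · rintro H u v ⟨_, huv | huv⟩
    · exact H u v huv
    · exact (H v u huv).symm

theorem csf_tadpoleG (N m l : ℕ) :
    csf (tadpoleG (m + 2) l) N = tadpoleSum N (m + 1) l := by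
  have hE (u : ℕ) : (u, u) ∉ chainE (List.range (m + 2) ++ [0])
      ++ chainE (0 :: (List.range l).map (· + (m + 2))) := by
    rw [List.mem_append, mem_cycle_chainE, mem_tail_chainE]; omega
  have hiff (c : Fin N) (f : Fin (m + 1) → Fin N) (g : Fin l → Fin N) :
      (∀ u v, (tadpoleG (m + 2) l).Adj u v →
          Fin.append (Fin.cons c f : Fin (m + 2) → Fin N) g u
            ≠ Fin.append (Fin.cons c f : Fin (m + 2) → Fin N) g v)
        ↔ ((∀ i : Fin (m + 1), (Fin.cons c f : Fin (m + 2) → Fin N) i.castSucc ≠ f i)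
            ∧ (Fin.cons c f : Fin (m + 2) → Fin N) (Fin.last (m + 1)) ≠ c)
          ∧ ∀ i : Fin l, (Fin.cons c g : Fin (l + 1) → Fin N) i.castSucc ≠ g i := by
    rw [tadpoleG, proper_graphOfEdges_iff hE]
    simp only [List.mem_append, mem_cycle_chainE, mem_tail_chainE]
    constructor
    · intro H
      refine ⟨⟨fun i => ?_, ?_⟩, fun i => ?_⟩
      · have := H (Fin.castAdd l i.castSucc) (Fin.castAdd l i.succ)
          (Or.inl (Or.inl (by simp [i.is_le])))
        simpa only [Fin.append_left, Fin.cons_succ] using this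
      · have := H (Fin.castAdd l (Fin.last (m + 1))) (Fin.castAdd l 0) (by simp)
        simpa only [Fin.append_left, Fin.cons_zero] using this
      · rcases l with _ | l
        · exact i.elim0
        · cases i using Fin.cases with
          | zero =>
            have := H (Fin.castAdd (l + 1) 0) (Fin.natAdd (m + 2) 0) (by simp)
            simpa only [Fin.append_left, Fin.append_right, Fin.castSucc_zero, Fin.cons_zero]
              using this
          | succ j =>
            have := H (Fin.natAdd (m + 2) j.castSucc) (Fin.natAdd (m + 2) j.succ)
              (Or.inr (Or.inr (by simp; omega)))
            simpa only [Fin.append_right, ← Fin.succ_castSucc, Fin.cons_succ] using this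
    · rintro ⟨⟨H₁, H₂⟩, H₃⟩ u v ((⟨hu, hv⟩ | ⟨hu, hv⟩) | ⟨hu, hv, hl⟩ | ⟨hu, hv, hl⟩)
      · obtain ⟨i, rfl⟩ : ∃ i : Fin (m + 1), u = Fin.castAdd l i.castSucc := ⟨⟨u, hu⟩, rfl⟩
        obtain rfl : v = Fin.castAdd l i.succ := Fin.ext hv
        simpa only [Fin.append_left, Fin.cons_succ] using H₁ i
      · obtain rfl : u = Fin.castAdd l (Fin.last (m + 1)) := Fin.ext hu
        obtain rfl : v = Fin.castAdd l 0 := Fin.ext hv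
        simpa only [Fin.append_left, Fin.cons_zero] using H₂
      · obtain ⟨l, rfl⟩ := Nat.exists_eq_succ_of_ne_zero hl.ne'
        obtain rfl : u = Fin.castAdd (l + 1) 0 := Fin.ext hu
        obtain rfl : v = Fin.natAdd (m + 2) 0 := Fin.ext hv
        simpa only [Fin.append_left, Fin.append_right, Fin.castSucc_zero, Fin.cons_zero] using H₃ 0
      · obtain ⟨l, rfl⟩ := Nat.exists_eq_succ_of_ne_zero (n := l) (by omega)
        obtain ⟨j, rfl⟩ : ∃ j : Fin l, u = Fin.natAdd (m + 2) j.castSucc :=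
          ⟨⟨u - (m + 2), by omega⟩, Fin.ext (by simp; omega)⟩
        obtain rfl : v = Fin.natAdd (m + 2) j.succ := Fin.ext (by simp at hv ⊢; omega)
        simpa only [Fin.append_right, ← Fin.succ_castSucc, Fin.cons_succ] using H₃ j.succ
  have hcsf : csf (tadpoleG (m + 2) l) N = ∑ κ : Fin (m + 2 + l) → Fin N,
      if ∀ u v, (tadpoleG (m + 2) l).Adj u v → κ u ≠ κ v then ∏ v, X (κ v) else 0 := by
    rw [csf]; congr!
  rw [hcsf, tadpoleSum, ← (Fin.appendEquiv (m + 2) l).sum_comp, Fintype.sum_prod_type,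
    ← (Fin.consEquiv fun _ => Fin N).sum_comp, Fintype.sum_prod_type]
  refine Finset.sum_congr rfl fun c _ => ?_
  rw [closedSum, openSum, ← sum_proper_eq_walkSum, ← sum_proper_eq_walkSum, mul_assoc,
    Finset.sum_mul, Finset.mul_sum]
  refine Finset.sum_congr rfl fun f _ => ?_
  rw [Finset.mul_sum, Finset.mul_sum]
  refine Finset.sum_congr rfl fun g _ => ?_
  simp only [Fin.appendEquiv, Fin.consEquiv, Equiv.coe_fn_mk, hiff, Fin.prod_univ_add,
    Fin.append_left, Fin.append_right, Fin.prod_univ_succ (n := m + 1), Fin.cons_zero,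
    Fin.cons_succ, ite_and]
  split_ifs <;> ring

/-! ### Generating functions -/

section GeneratingFunctions

theorem openSum_eq_sum_antidiagonal {N : ℕ} (m : ℕ) (c : Fin N) :
    openSum N m c = ∑ p ∈ antidiagonal m, (-X c) ^ p.1 * pathSum N p.2 := by
  induction m with
  | zero => simp [openSum, walkSum, pathSum]
  | succ m ih =>
    rw [openSum_succ, ih, Finset.Nat.sum_antidiagonal_succ, Finset.mul_sum, sub_eq_add_neg,
      ← Finset.sum_neg_distrib]
    simp only [pow_zero, one_mul, pow_succ]
    congr 1
    exact Finset.sum_congr rfl fun _ _ => by ring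

/-- The coefficient sequence `(-1)^(j-1) p_j` of the logarithmic derivative of `∑ e_j z^j`. -/
noncomputable def signedPsum (N j : ℕ) : MvPolynomial (Fin N) ℝ :=
  if j = 0 then 0 else (-1) ^ (j + 1) * psum (Fin N) ℝ j

theorem pathSum_succ (N m : ℕ) :
    pathSum N (m + 1) = ∑ p ∈ antidiagonal (m + 1), signedPsum N p.1 * pathSum N p.2 := by
  rw [pathSum, Finset.Nat.sum_antidiagonal_succ]
  simp only [openSum_eq_sum_antidiagonal, Finset.mul_sum]
  rw [Finset.sum_comm]
  simp only [signedPsum, if_pos, zero_mul, zero_add, Nat.add_eq_zero_iff, one_ne_zero, and_false,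
    if_false, psum, Finset.sum_mul, Finset.mul_sum]
  refine Finset.sum_congr rfl fun p _ => Finset.sum_congr rfl fun c _ => ?_
  rw [neg_pow]
  ring

theorem mul_esymm_eq_sum_signedPsum (N k : ℕ) :
    (k : MvPolynomial (Fin N) ℝ) * esymm (Fin N) ℝ k
      = ∑ p ∈ antidiagonal k, signedPsum N p.1 * esymm (Fin N) ℝ p.2 := by
  rw [MvPolynomial.mul_esymm_eq_sum, Finset.mul_sum, Finset.sum_filter,
    ← Finset.Nat.sum_antidiagonal_swap]
  refine Finset.sum_congr rfl fun p hp => ?_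
  rw [HasAntidiagonal.mem_antidiagonal] at hp
  simp only [Prod.fst_swap, Prod.snd_swap, signedPsum]
  by_cases h : p.1 = 0
  · rw [if_neg (by omega), if_pos h, zero_mul]
  · rw [if_pos (by omega), if_neg h, ← hp]
    have : ((-1 : MvPolynomial (Fin N) ℝ)) ^ (p.2 + p.2) = 1 := Even.neg_one_pow ⟨_, rfl⟩
    linear_combination (-1) ^ (p.1 + 1) * psum (Fin N) ℝ p.1 * esymm (Fin N) ℝ p.2 * this

/-- If `Q` is the inverse of `1 - ∑ (j-1) e_j z^j`, then the generating function of the paths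
is `∑ e_j z^j` times that of `Q`. -/
theorem pathSum_eq_sum_mul {N : ℕ} {Q : ℕ → MvPolynomial (Fin N) ℝ} (hQ₀ : Q 0 = 1)
    (hQ : ∀ m, Q (m + 1)
      = ∑ p ∈ antidiagonal m, (p.1 : MvPolynomial (Fin N) ℝ) * esymm (Fin N) ℝ (p.1 + 1) * Q p.2)
    (m : ℕ) :
    pathSum N (m + 1) = ∑ p ∈ antidiagonal m,
      ((p.1 + 1 : ℕ) : MvPolynomial (Fin N) ℝ) * esymm (Fin N) ℝ (p.1 + 1) * Q p.2 := by
  set E : PowerSeries (MvPolynomial (Fin N) ℝ) := PowerSeries.mk (esymm (Fin N) ℝ)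
  set D : PowerSeries (MvPolynomial (Fin N) ℝ) := PowerSeries.mk fun k => k * esymm (Fin N) ℝ k
  set S : PowerSeries (MvPolynomial (Fin N) ℝ) := PowerSeries.mk (signedPsum N)
  set P : PowerSeries (MvPolynomial (Fin N) ℝ) := PowerSeries.mk (pathSum N)
  set R : PowerSeries (MvPolynomial (Fin N) ℝ) := PowerSeries.mk Q
  have hD : D = S * E := by
    ext1 k
    simp [D, S, E, PowerSeries.coeff_mul, mul_esymm_eq_sum_signedPsum]
  have hP : P = 1 + S * P := by
    ext1 k
    rcases k with _ | k
    · simp [P, S, pathSum, signedPsum]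
    · simp [P, S, PowerSeries.coeff_mul, PowerSeries.coeff_one, pathSum_succ N k]
  have hR : E * R = 1 + D * R := by
    ext1 k
    rcases k with _ | k
    · simp [E, D, R, PowerSeries.coeff_mul, hQ₀]
    · simp only [E, D, R, PowerSeries.coeff_mul, PowerSeries.coeff_one, PowerSeries.coeff_mk,
        map_add, Finset.Nat.sum_antidiagonal_succ, esymm_zero, hQ k, Nat.cast_zero]
      simp only [Nat.succ_ne_zero, if_false, one_mul, zero_mul, zero_add, ← Finset.sum_add_distrib]
      refine Finset.sum_congr rfl fun p _ => ?_
      push_cast; ring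
  have hPR : P = 1 + D * R := by
    linear_combination R * E * hP - R * P * hD + (1 - P) * hR
  have := congrArg (PowerSeries.coeff (m + 1)) hPR
  simpa [P, D, R, PowerSeries.coeff_mul, PowerSeries.coeff_one,
    Finset.Nat.sum_antidiagonal_succ] using this

end GeneratingFunctions

/-! ### Sums over compositions -/

section Compositions

theorem List.IsPrefix.eq_of_sum_eq {J J' : List ℕ} (h : J <+: J') (hJ' : ∀ i ∈ J', 0 < i)
    (hsum : J.sum = J'.sum) : J = J' := by
  obtain ⟨T, rfl⟩ := h
  rcases T with _ | ⟨t, T⟩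
  · simp
  · have := hJ' t (by simp)
    simp at hsum
    omega

theorem Composition.append_injective (m k : ℕ) :
    Function.Injective fun p : Composition m × Composition k => p.1.append p.2 := by
  rintro ⟨J, K⟩ ⟨J', K'⟩ h
  have h' : J.blocks ++ K.blocks = J'.blocks ++ K'.blocks := congrArg Composition.blocks h
  have hJ : J.blocks = J'.blocks := by
    rcases List.prefix_or_prefix_of_prefix (List.prefix_append J.blocks K.blocks)
      (h' ▸ List.prefix_append J'.blocks K'.blocks) with hp | hp
    · exact hp.eq_of_sum_eq (fun _ => J'.blocks_pos) (by simp)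
    · exact (hp.eq_of_sum_eq (fun _ => J.blocks_pos) (by simp)).symm
  rw [hJ] at h'
  exact Prod.ext (Composition.ext hJ) (Composition.ext (List.append_cancel_left h'))

theorem Composition.exists_eq_append {m k : ℕ} (I : Composition (m + k)) {r : ℕ}
    (hr : (I.blocks.take r).sum = m) : ∃ J : Composition m, ∃ K : Composition k,
      J.append K = I := by
  have hs := I.blocks_sum
  rw [← List.take_append_drop r I.blocks, List.sum_append, hr] at hs
  exact ⟨⟨_, fun h => I.blocks_pos (List.mem_of_mem_take h), hr⟩,
    ⟨_, fun h => I.blocks_pos (List.mem_of_mem_drop h), by omega⟩,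
    Composition.ext (List.take_append_drop r I.blocks)⟩

/-- A sum over the compositions of `m + k` supported on those having `m` as a partial sum. -/
theorem Composition.sum_eq_sum_append {R : Type*} [AddCommMonoid R] (m k : ℕ)
    (F : List ℕ → R)
    (hF : ∀ I : Composition (m + k), (∀ r, (I.blocks.take r).sum ≠ m) → F I.blocks = 0) :
    ∑ I : Composition (m + k), F I.blocks
      = ∑ J : Composition m, ∑ K : Composition k, F (J.blocks ++ K.blocks) := by
  rw [← Fintype.sum_prod_type' (f := fun (J : Composition m) (K : Composition k) =>
    F (J.blocks ++ K.blocks))]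
  symm
  refine Fintype.sum_of_injective _ (Composition.append_injective m k) _ _ (fun I hI => ?_)
    fun _ => rfl
  refine hF I fun r hr => hI ?_
  obtain ⟨J, K, h⟩ := I.exists_eq_append hr
  exact ⟨(J, K), h⟩

theorem Composition.sum_zero {R : Type*} [AddCommMonoid R] (F : List ℕ → R) :
    ∑ I : Composition 0, F I.blocks = F [] := by
  have h (I : Composition 0) : I.blocks = [] := I.blocks_eq_nil.2 rfl
  simp [h, composition_card]

/-- Splitting a sum over compositions according to the first part. -/
theorem Composition.sum_succ {R : Type*} [AddCommMonoid R] (n : ℕ) (F : List ℕ → R) :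
    ∑ I : Composition (n + 1), F I.blocks
      = ∑ p ∈ antidiagonal n, ∑ J : Composition p.2, F ((p.1 + 1) :: J.blocks) := by
  rw [Finset.sum_sigma']
  symm
  refine Finset.sum_bij
    (fun q hq => ⟨(q.1.1 + 1) :: q.2.blocks, ?_, ?_⟩) ?_ ?_ ?_ ?_
  · intro i hi
    rcases List.mem_cons.1 hi with rfl | hi
    · omega
    · exact q.2.blocks_pos hi
  · simp at hq
    simp; omega
  · simp
  · rintro ⟨⟨a, b⟩, J⟩ h ⟨⟨a', b'⟩, J'⟩ h' heq
    simp at h h' heq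
    obtain rfl := heq.1
    obtain rfl : b = b' := by omega
    rw [Composition.ext heq.2]
  · rintro ⟨I, hpos, hsum⟩ -
    rcases I with _ | ⟨i, I⟩
    · simp at hsum
    · have := @hpos i (by simp)
      obtain ⟨i, rfl⟩ := Nat.exists_eq_succ_of_ne_zero this.ne'
      refine ⟨⟨(i, I.sum), ⟨I, fun h => hpos (List.mem_cons_of_mem _ h), rfl⟩⟩, ?_, rfl⟩
      simp at hsum ⊢
      omega
  · intros; rfl

end Compositions

/-! ### The coefficients `Θ⁺` -/

section Theta

theorem sigmaP_eq_of_take_sum {I : List ℕ} {a s k : ℕ} (hk : k ≤ I.length)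
    (hs : (I.take k).sum = s) (has : a ≤ s) (hmin : ∀ j, a ≤ (I.take j).sum → s ≤ (I.take j).sum) :
    sigmaP I a = s := by
  refine IsLeast.csInf_eq ⟨⟨k, hk, by rw [hs], by exact_mod_cast has⟩, ?_⟩
  rintro x ⟨j, -, rfl, hj⟩
  exact_mod_cast hmin j (by exact_mod_cast hj)

theorem thetaP_sum (I : List ℕ) : thetaP I I.sum = 0 := by
  rw [thetaP, sigmaP_eq_of_take_sum le_rfl (by rw [List.take_length]) le_rfl fun _ => id, sub_self]

theorem thetaP_sub_of_forall_ne {I : List ℕ} {m : ℕ} (h : ∀ r, (I.take r).sum ≠ m) :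
    thetaP I m - thetaP I (m + 1 : ℕ) = 1 := by
  have : sigmaP I m = sigmaP I (m + 1 : ℕ) := by
    unfold sigmaP
    congr 1
    ext x
    refine exists_congr fun k => and_congr_right fun _ => and_congr_right ?_
    rintro rfl
    have := h k
    norm_cast
    omega
  rw [thetaP, thetaP, this]
  push_cast; ring

theorem thetaP_append_cons (J K : List ℕ) {k : ℕ} (hk : 0 < k) :
    thetaP (J ++ k :: K) J.sum = 0
      ∧ thetaP (J ++ k :: K) (J.sum + 1 : ℕ) = k - 1 := by
  constructor
  · rw [thetaP, sigmaP_eq_of_take_sum (k := J.length) (s := J.sum) (by simp) (by simp) le_rfl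
      fun _ => id, sub_self]
  · rw [thetaP, sigmaP_eq_of_take_sum (k := J.length + 1) (s := J.sum + k) (by simp)
      (by simp [List.take_append, List.take_of_length_le]) (by omega) ?_]
    · push_cast; ring
    · intro j hj
      rw [List.take_append, List.sum_append] at hj ⊢
      rcases h : j - J.length with _ | i
      · have := (List.take_sublist j J).sum_le_sum (by simp)
        simp [h] at hj
        omega
      · rw [List.take_of_length_le (by omega)]
        simp

end Theta

/-! ### Expansions over compositions -/

section Expansions

theorem eComp_cons (N i : ℕ) (I : List ℕ) :
    eComp N (i :: I) = esymm (Fin N) ℝ i * eComp N I := by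
  simp [eComp]

theorem eComp_append (N : ℕ) (I J : List ℕ) : eComp N (I ++ J) = eComp N I * eComp N J := by
  simp [eComp]

theorem wI_append {J : List ℕ} (hJ : J ≠ []) (K : List ℕ) :
    wI (J ++ K) = wI J * (K.map (· - 1)).prod := by
  rcases J with _ | ⟨j, J⟩
  · exact absurd rfl hJ
  · simp [wI, mul_assoc]

theorem pathSum_eq_sum_composition (N m : ℕ) :
    pathSum N m = ∑ I : Composition m, C (wI I.blocks : ℝ) * eComp N I.blocks := by
  rcases m with _ | m
  · rw [Composition.sum_zero fun I => C (wI I : ℝ) * eComp N I]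
    simp [pathSum, wI, eComp]
  · rw [pathSum_eq_sum_mul (Q := fun k => ∑ I : Composition k,
        C (((I.blocks.map (· - 1)).prod : ℕ) : ℝ) * eComp N I.blocks),
      Composition.sum_succ m fun I => C (wI I : ℝ) * eComp N I]
    · refine Finset.sum_congr rfl fun p _ => ?_
      rw [Finset.mul_sum]
      refine Finset.sum_congr rfl fun I _ => ?_
      simp only [wI, eComp_cons, Nat.cast_mul, map_mul, map_natCast]
      ring
    · rw [Composition.sum_zero fun I => C (((I.map (· - 1)).prod : ℕ) : ℝ) * eComp N I]
      simp [eComp]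
    · intro k
      rw [Composition.sum_succ k fun I => C (((I.map (· - 1)).prod : ℕ) : ℝ) * eComp N I]
      refine Finset.sum_congr rfl fun p _ => ?_
      rw [Finset.mul_sum]
      refine Finset.sum_congr rfl fun I _ => ?_
      simp only [List.map_cons, List.prod_cons, eComp_cons, Nat.cast_mul, map_mul, map_natCast,
        Nat.add_sub_cancel]
      ring

theorem sum_thetaP_sub (N : ℕ) {m k : ℕ} (hm : m ≠ 0) (hk : k ≠ 0) :
    ∑ I : Composition (m + k),
        C ((thetaP I.blocks m - thetaP I.blocks (m + 1 : ℕ)) * (wI I.blocks : ℝ))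
          * eComp N I.blocks
      = pathSum N (m + k) - pathSum N m * ∑ K : Composition k,
          C (thetaP K.blocks (1 : ℕ) * (wI K.blocks : ℝ)) * eComp N K.blocks := by
  have hsplit := Composition.sum_eq_sum_append m k
    (fun I => C ((1 - (thetaP I m - thetaP I (m + 1 : ℕ))) * (wI I : ℝ)) * eComp N I)
    fun I hI => by rw [thetaP_sub_of_forall_ne hI]; simp
  rw [eq_sub_iff_add_eq', pathSum_eq_sum_composition N m, Finset.sum_mul_sum]
  have hterm (J : Composition m) (K : Composition k) :
      C (wI J.blocks : ℝ) * eComp N J.blocks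
          * (C (thetaP K.blocks (1 : ℕ) * (wI K.blocks : ℝ)) * eComp N K.blocks)
        = C ((1 - (thetaP (J.blocks ++ K.blocks) m - thetaP (J.blocks ++ K.blocks) (m + 1 : ℕ)))
            * (wI (J.blocks ++ K.blocks) : ℝ)) * eComp N (J.blocks ++ K.blocks) := by
    rw [wI_append (mt J.blocks_eq_nil.1 hm), eComp_append]
    rcases hK : K.blocks with _ | ⟨i, K'⟩
    · exact absurd (K.blocks_eq_nil.1 hK) hk
    · have hi : 0 < i := K.blocks_pos (by simp [hK])
      have h₁ := thetaP_append_cons J.blocks K' hi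
      have h₂ := (thetaP_append_cons [] K' hi).2
      rw [J.blocks_sum] at h₁
      simp only [List.nil_append, List.sum_nil, zero_add] at h₂
      rw [h₁.1, h₁.2, h₂]
      obtain ⟨i, rfl⟩ := Nat.exists_eq_succ_of_ne_zero hi.ne'
      simp only [wI, List.map_cons, List.prod_cons, map_mul, map_sub, map_natCast, map_one,
        map_zero, Nat.cast_mul, Nat.succ_eq_add_one, Nat.add_sub_cancel]
      push_cast
      ring
  simp_rw [hterm]
  rw [← hsplit, ← Finset.sum_add_distrib, pathSum_eq_sum_composition]
  refine Finset.sum_congr rfl fun I _ => ?_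
  rw [← add_mul, ← map_add]
  congr 2
  ring

theorem tadpoleSum_eq_sum_composition (N m l n : ℕ) (hn : n = l + 1 + m) :
    tadpoleSum N m l = ∑ I : Composition n,
      C (thetaP I.blocks (l + 1 : ℕ) * (wI I.blocks : ℝ)) * eComp N I.blocks := by
  induction m generalizing l n with
  | zero =>
    obtain rfl : n = l + 1 := hn
    rw [tadpoleSum_zero]
    refine (Finset.sum_eq_zero fun I _ => ?_).symm
    have := thetaP_sum I.blocks
    rw [I.blocks_sum] at this
    rw [this]
    simp
  | succ m ih =>
    subst hn
    rw [tadpoleSum_succ, ih (l + 1) (l + 1 + (m + 1)) (by omega), ih 0 (m + 1) (by omega),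
      show m + 1 + 1 + l = l + 1 + (m + 1) by omega, zero_add,
      ← sum_thetaP_sub N l.succ_ne_zero m.succ_ne_zero, ← Finset.sum_add_distrib]
    refine Finset.sum_congr rfl fun I _ => ?_
    rw [← add_mul, ← map_add]
    congr 2
    ring

end Expansions

/-- `X_{C_{n−l}^l} = Σ_{I ⊨ n} Θ⁺_I(l+1) w_I e_I` for `0 ≤ l ≤ n − 2`. -/
theorem stmt4 (n l : ℕ) (hl : l + 2 ≤ n) (N : ℕ) :
    csf (tadpoleG (n - l) l) N
      = ∑ I : Composition n,
          MvPolynomial.C (thetaP I.blocks (l + 1) * (wI I.blocks : ℝ))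
            * eComp N I.blocks := by
  obtain ⟨m, hm⟩ : ∃ m, n - l = m + 2 := ⟨n - l - 2, by omega⟩
  rw [hm, csf_tadpoleG, tadpoleSum_eq_sum_composition N (m + 1) l n (by omega)]
  simp only [Nat.cast_add, Nat.cast_one]
end

section
/- Let a ≥ b ≥ 2 and n = a + b + 1. Then X_{θ_{ab2}} = Σ_{I ⊨ n} D_I w_I e_I, where D_I = Θ⁺_I(2) − Θ⁻_{\overline{φ(I)}}(a) + Δ_I(b+1). -/
open scoped Classical
open MvPolynomial Finset

namespace Clock

section Walks

variable {ι R : Type*} [Fintype ι] [CommRing R] (x : ι → R)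

/-- The weighted count of proper colorings of the `k` interior vertices of a path of length
`k + 1` whose end vertices have colors `i` and `j`. -/
noncomputable def walk : ℕ → ι → ι → R
  | 0, i, j => if i = j then 0 else 1
  | k + 1, i, j => ∑ l, x l * walk k l j - x i * walk k i j

/-- The weighted count of proper colorings of the other `k` vertices of a path on `k + 1` vertices
that starts with color `i`. -/
def ray : ℕ → ι → R
  | 0, _ => 1
  | k + 1, i => ∑ l, x l * ray k l - x i * ray k i

/-- The weighted count of proper colorings of the path on `k` vertices. -/
def pathSum : ℕ → R
  | 0 => 1
  | k + 1 => ∑ l, x l * ray x k l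

/-- The weighted count for the tadpole with a cycle on `c + 1` vertices and a tail of length `l`. -/
noncomputable def tadpoleSum (c l : ℕ) : R := ∑ j, x j * ray x l j * walk x c j j

/-- The weighted count for two cycles on `c + 1` and `d + 1` vertices that share a vertex. -/
noncomputable def twoCycleSum (c d : ℕ) : R := ∑ j, x j * walk x c j j * walk x d j j

theorem ray_succ (k : ℕ) (i : ι) : ray x (k + 1) i = pathSum x (k + 1) - x i * ray x k i := rfl

theorem walk_zero_self (i : ι) : walk x 0 i i = 0 := by simp [walk]

theorem walk_succ_right (k : ℕ) (i j : ι) :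
    walk x (k + 1) i j = ∑ l, walk x k i l * x l - walk x k i j * x j := by
  induction k generalizing i j with
  | zero =>
    simp only [walk, mul_ite, ite_mul, mul_zero, zero_mul, mul_one, one_mul]
    have h (p : ι → Prop) : ∑ l, (if p l then 0 else x l)
        = ∑ l, x l - ∑ l, (if p l then x l else 0) := by
      rw [← Finset.sum_sub_distrib]
      exact Finset.sum_congr rfl fun l _ => by split_ifs <;> simp
    rw [h fun l => l = j, h fun l => i = l]
    simp only [Finset.sum_ite_eq, Finset.sum_ite_eq', Finset.mem_univ, if_true]
    split_ifs with hij
    · subst hij; ring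
    · ring
  | succ k ih =>
    conv_lhs => rw [walk, Finset.sum_congr rfl fun l _ => congrArg (x l * ·) (ih l j), ih i j]
    simp only [walk, mul_sub, sub_mul, Finset.sum_sub_distrib, Finset.mul_sum, Finset.sum_mul]
    rw [Finset.sum_comm]
    simp only [← mul_assoc]
    ring

theorem walk_comm (k : ℕ) (i j : ι) : walk x k i j = walk x k j i := by
  induction k generalizing i j with
  | zero => simp [walk, eq_comm]
  | succ k ih =>
    rw [walk_succ_right, walk, ih i j]
    congr 1
    · exact Finset.sum_congr rfl fun l _ => by rw [ih i l, mul_comm]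
    · ring

theorem sum_mul_walk (k : ℕ) (j : ι) : ∑ i, x i * walk x k i j = ray x (k + 1) j := by
  induction k generalizing j with
  | zero =>
    have h : ∀ i, x i * walk x 0 i j = x i - if i = j then x i else 0 := fun i => by
      unfold walk; split_ifs <;> simp
    simp [h, ray]
  | succ k ih =>
    simp only [walk_succ_right, mul_sub, Finset.mul_sum, Finset.sum_sub_distrib]
    rw [Finset.sum_comm]
    simp only [← mul_assoc, ← Finset.sum_mul, ih]
    rw [ray.eq_2 x j (k + 1), mul_comm (x j)]
    exact congrArg (· - _) (Finset.sum_congr rfl fun l _ => mul_comm _ _)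

theorem walk_succ (k : ℕ) (i j : ι) :
    walk x (k + 1) i j = ray x (k + 1) j - x i * walk x k i j := by
  rw [walk, sum_mul_walk]

theorem sum_walk_mul_walk (a b : ℕ) (i j : ι) :
    ∑ l, walk x a i l * x l * walk x b l j = walk x (a + b + 1) i j := by
  induction a generalizing i with
  | zero =>
    have h : ∀ l, walk x 0 i l * x l * walk x b l j
        = x l * walk x b l j - if i = l then x l * walk x b l j else 0 := fun l => by
      rw [walk]; split_ifs <;> simp
    rw [Finset.sum_congr rfl fun l _ => h l, zero_add, walk]
    simp
  | succ a ih =>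
    rw [show a + 1 + b + 1 = a + b + 1 + 1 by ring, walk.eq_2 x i j (a + b + 1)]
    simp only [← ih]
    rw [Finset.sum_congr rfl fun l _ => by rw [walk.eq_2]]
    simp only [sub_mul, Finset.sum_sub_distrib, Finset.mul_sum, Finset.sum_mul]
    rw [Finset.sum_comm]
    simp only [← mul_assoc]

theorem sum_ray_mul_ray (l m : ℕ) :
    ∑ j, x j * ray x l j * ray x m j = pathSum x (l + m + 1) := by
  induction m generalizing l with
  | zero => simp [ray, pathSum]
  | succ m ih =>
    have h : ∀ j, x j * ray x l j * ray x (m + 1) j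
        = x j * ray x l j * pathSum x (m + 1) - x j * ray x m j * pathSum x (l + 1)
          + x j * ray x (l + 1) j * ray x m j := fun j => by
      rw [ray_succ x m, ray_succ x l]; ring
    rw [Finset.sum_congr rfl fun j _ => h j, Finset.sum_add_distrib, Finset.sum_sub_distrib,
      ← Finset.sum_mul, ← Finset.sum_mul, ih, pathSum, pathSum,
      show l + (m + 1) + 1 = l + 1 + m + 1 by ring]
    ring

theorem tadpoleSum_zero_left (l : ℕ) : tadpoleSum x 0 l = 0 := by
  simp [tadpoleSum, walk_zero_self]

theorem tadpoleSum_succ (c l : ℕ) :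
    tadpoleSum x (c + 1) l
      = pathSum x (c + l + 2) - pathSum x (l + 1) * tadpoleSum x c 0
        + tadpoleSum x c (l + 1) := by
  have h : ∀ j, x j * ray x l j * walk x (c + 1) j j
      = x j * ray x l j * ray x (c + 1) j - pathSum x (l + 1) * (x j * ray x 0 j * walk x c j j)
        + x j * ray x (l + 1) j * walk x c j j := fun j => by
    rw [walk_succ, ray_succ x l, ray]; ring
  simp only [tadpoleSum]
  rw [Finset.sum_congr rfl fun j _ => h j, Finset.sum_add_distrib, Finset.sum_sub_distrib,
    ← Finset.mul_sum, sum_ray_mul_ray, show l + (c + 1) + 1 = c + l + 2 by ring]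

theorem twoCycleSum_zero_left (d : ℕ) : twoCycleSum x 0 d = 0 := by
  simp [twoCycleSum, walk_zero_self]

theorem sum_sq_mul_walk (c d : ℕ) :
    ∑ j, x j ^ 2 * walk x c j j * walk x d j j
      = tadpoleSum x c (d + 1) - twoCycleSum x c (d + 1) := by
  rw [tadpoleSum, twoCycleSum, ← Finset.sum_sub_distrib]
  exact Finset.sum_congr rfl fun j _ => by rw [walk_succ x d]; ring

theorem twoCycleSum_comm (c d : ℕ) : twoCycleSum x c d = twoCycleSum x d c :=
  Finset.sum_congr rfl fun j _ => by ring

theorem twoCycleSum_succ (c d : ℕ) :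
    twoCycleSum x (c + 1) d
      = tadpoleSum x d (c + 1) - tadpoleSum x c (d + 1) + twoCycleSum x c (d + 1) := by
  have h : ∑ j, x j ^ 2 * walk x c j j * walk x d j j
      = ∑ j, x j ^ 2 * walk x d j j * walk x c j j :=
    Finset.sum_congr rfl fun j _ => by ring
  rw [sum_sq_mul_walk, sum_sq_mul_walk, twoCycleSum_comm x d] at h
  linear_combination h

/-- The clock graph in terms of tadpoles and pairs of cycles that share a vertex. -/
theorem sum_walk_clock (a b : ℕ) :
    ∑ i, ∑ j, x i * x j * walk x a i j * walk x b i j * walk x 1 i j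
      = tadpoleSum x (a + b + 1) 1 - tadpoleSum x (a + 1) (b + 1) + tadpoleSum x (a + b + 2) 0
        - tadpoleSum x a (b + 2) + twoCycleSum x a (b + 2) := by
  have hcl (c d : ℕ) (f : ι → R) : ∑ i, ∑ j, x i * x j * walk x c i j * walk x d i j * f j
      = ∑ j, x j * f j * walk x (c + d + 1) j j := by
    rw [Finset.sum_comm]
    refine Finset.sum_congr rfl fun j _ => ?_
    rw [← sum_walk_mul_walk, Finset.mul_sum]
    exact Finset.sum_congr rfl fun i _ => by rw [walk_comm x c i j]; ring
  have h0 : ∀ i j, x i * x j * walk x a i j * walk x (b + 1) i j * walk x 0 i j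
      = x i * x j * walk x a i j * walk x (b + 1) i j * 1
        - if i = j then x j ^ 2 * walk x a j j * walk x (b + 1) j j else 0 := fun i j => by
    rw [walk.eq_1]
    split_ifs with hij
    · subst hij; ring
    · ring
  have h1 : ∀ i j, x i * x j * walk x a i j * walk x b i j * walk x 1 i j
      = x i * x j * walk x a i j * walk x b i j * ray x 1 j
        - x i * x j * walk x a i j * walk x 0 i j * ray x (b + 1) j
        + x i * x j * walk x a i j * walk x (b + 1) i j * walk x 0 i j := fun i j => by
    rw [walk_succ x 0, walk_succ x b]; ring
  simp only [h1]
  simp only [h0, Finset.sum_add_distrib, Finset.sum_sub_distrib, Finset.sum_ite_eq,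
    Finset.mem_univ, if_true]
  rw [hcl a b, hcl a 0, hcl a (b + 1) fun _ => 1, sum_sq_mul_walk]
  simp only [tadpoleSum, ray.eq_1, ← add_assoc, add_zero]
  ring

end Walks

section Compositions

variable {R : Type*} [CommRing R] (e : ℕ → R)

theorem sum_composition_zero {M : Type*} [AddCommMonoid M] (F : List ℕ → M) :
    ∑ I : Composition 0, F I.blocks = F [] := by
  have h (I : Composition 0) : I.blocks = [] :=
    List.length_eq_zero_iff.mp (Nat.le_zero.mp I.length_le)
  simp only [h, Finset.sum_const, Finset.card_univ, composition_card, Nat.zero_sub, pow_zero,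
    one_smul]

/-- Sum over compositions by the first part. -/
theorem sum_composition_succ {M : Type*} [AddCommMonoid M] (n : ℕ) (F : List ℕ → M) :
    ∑ I : Composition (n + 1), F I.blocks
      = ∑ i ∈ Finset.range (n + 1), ∑ J : Composition (n - i), F ((i + 1) :: J.blocks) := by
  rw [Finset.sum_sigma']
  symm
  refine Finset.sum_bij (fun s hs => ⟨(s.1 + 1) :: s.2.blocks, ?_, ?_⟩) ?_ ?_ ?_ ?_
  · intro k hk
    rcases List.mem_cons.mp hk with rfl | hk
    · exact Nat.succ_pos _
    · exact s.2.blocks_pos hk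
  · have := Finset.mem_range.mp (Finset.mem_sigma.mp hs).1
    rw [List.sum_cons, s.2.blocks_sum]
    omega
  · intros; exact Finset.mem_univ _
  · rintro ⟨i, I⟩ _ ⟨j, J⟩ _ h
    have h' := congrArg Composition.blocks h
    simp only [List.cons.injEq, add_left_inj] at h'
    obtain ⟨rfl, h'⟩ := h'
    rw [Composition.ext h']
  · rintro I -
    obtain ⟨l, hpos, hsum⟩ := I
    cases l with
    | nil => simp at hsum
    | cons i t =>
      have hi : 0 < i := hpos (by simp)
      rw [List.sum_cons] at hsum
      refine ⟨⟨i - 1, t, fun h => hpos (List.mem_cons_of_mem _ h), by omega⟩, ?_, ?_⟩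
      · simp only [Finset.mem_sigma, Finset.mem_range, Finset.mem_univ, and_true]
        omega
      · ext1
        simp only [List.cons.injEq, and_true]
        omega
  · intros; rfl

/-- `(i₁ − 1)⋯(i_z − 1) e_I`. -/
def tailWeight (I : List ℕ) : R := (I.map fun i => ((i - 1 : ℕ) : R) * e i).prod

/-- `w_I e_I`. -/
def weight : List ℕ → R
  | [] => 1
  | i :: t => i * e i * tailWeight e t

/-- The distance from `m` to the smallest partial sum of `I` that is at least `m`. -/
def overshoot : List ℕ → ℕ → ℕ
  | [], _ => 0
  | i :: t, m => if m ≤ i then i - m else overshoot t (m - i)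

/-- The part of `I` following the partial sum `m`, or `0` if there is none. -/
def nextPart : List ℕ → ℕ → ℕ
  | [], _ => 0
  | i :: t, m => if m = 0 then i else if m < i then 0 else nextPart t (m - i)

theorem overshoot_sum (I : List ℕ) : overshoot I I.sum = 0 := by
  induction I with
  | nil => rfl
  | cons i t ih =>
    rw [overshoot, List.sum_cons]
    split_ifs
    · omega
    · rwa [Nat.add_sub_cancel_left]

theorem overshoot_add_nextPart (I : List ℕ) (hI : ∀ i ∈ I, 0 < i) (m : ℕ) (h1 : 1 ≤ m)
    (hm : m < I.sum) : overshoot I m + nextPart I m = overshoot I (m + 1) + 1 := by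
  induction I generalizing m with
  | nil => simp at hm
  | cons i t ih =>
    rw [List.sum_cons] at hm
    simp only [overshoot, nextPart]
    rcases lt_trichotomy m i with h | rfl | h
    · rw [if_pos h.le, if_neg (by omega), if_pos h, if_pos (by omega)]
      omega
    · rw [if_pos le_rfl, if_neg (by omega), if_neg (by omega), if_neg (by omega), Nat.sub_self,
        Nat.add_sub_cancel_left]
      cases t with
      | nil => simp at hm
      | cons j s =>
        have : 0 < j := hI j (by simp)
        rw [nextPart, overshoot, if_pos rfl, if_pos (by omega)]
        omega
    · rw [if_neg (by omega), if_neg (by omega), if_neg (by omega), if_neg (by omega),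
        ih (fun k hk => hI k (List.mem_cons_of_mem _ hk)) _ (by omega) (by omega),
        show m - i + 1 = m + 1 - i by omega]

/-- The sum of `tailWeight` over the compositions of `n`. -/
def tailSum (n : ℕ) : R := ∑ I : Composition n, tailWeight e I.blocks

/-- The sum of `w_I e_I` over the compositions of `n`. -/
def weightSum (n : ℕ) : R := ∑ I : Composition n, weight e I.blocks

/-- The sum of `Θ⁺_I(k) w_I e_I` over the compositions of `n`. -/
def overshootSum (n k : ℕ) : R :=
  ∑ I : Composition n, (overshoot I.blocks k : R) * weight e I.blocks

theorem tailSum_zero : tailSum e 0 = 1 := sum_composition_zero _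

theorem tailSum_succ (n : ℕ) :
    tailSum e (n + 1) = ∑ i ∈ Finset.range (n + 1), i * e (i + 1) * tailSum e (n - i) := by
  rw [tailSum, sum_composition_succ n (tailWeight e)]
  simp [tailSum, tailWeight, Finset.mul_sum]

theorem weightSum_zero : weightSum e 0 = 1 := sum_composition_zero _

theorem weightSum_succ (n : ℕ) :
    weightSum e (n + 1)
      = ∑ i ∈ Finset.range (n + 1), (i + 1) * e (i + 1) * tailSum e (n - i) := by
  rw [weightSum, sum_composition_succ n (weight e)]
  simp [tailSum, weight, Finset.mul_sum]

theorem overshootSum_zero_left (k : ℕ) : overshootSum e 0 k = 0 := by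
  rw [overshootSum, sum_composition_zero fun I => (overshoot I k : R) * weight e I]
  simp [overshoot]

theorem overshootSum_succ_one (n : ℕ) :
    overshootSum e (n + 1) 1
      = ∑ i ∈ Finset.range (n + 1), i * ((i + 1) * e (i + 1)) * tailSum e (n - i) := by
  rw [overshootSum, sum_composition_succ n fun I => (overshoot I 1 : R) * weight e I]
  simp [tailSum, overshoot, weight, Finset.mul_sum, mul_assoc]

theorem sum_nextPart_mul_tailWeight (k m n : ℕ) (hn : n = k + m) :
    ∑ I : Composition n, (nextPart I.blocks k : R) * tailWeight e I.blocks
      = tailSum e k * overshootSum e m 1 := by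
  induction k using Nat.strong_induction_on generalizing n with
  | _ k ih =>
  subst hn
  cases k with
  | zero =>
    rw [zero_add, tailSum_zero, one_mul]
    cases m with
    | zero =>
      rw [overshootSum_zero_left, sum_composition_zero fun I => (nextPart I 0 : R) * tailWeight e I]
      simp [nextPart]
    | succ m =>
      rw [overshootSum_succ_one, sum_composition_succ m
        fun I => (nextPart I 0 : R) * tailWeight e I]
      simp only [tailSum, Finset.mul_sum]
      refine Finset.sum_congr rfl fun i _ => Finset.sum_congr rfl fun J _ => ?_
      simp [nextPart, tailWeight]
      ring
  | succ k =>
    rw [show k + 1 + m = k + m + 1 by ring, sum_composition_succ (k + m)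
      fun I => (nextPart I (k + 1) : R) * tailWeight e I, tailSum_succ, Finset.sum_mul]
    symm
    refine Finset.sum_subset_zero_on_sdiff
      (Finset.range_subset_range.mpr (by omega)) (fun i hi => ?_) fun i hi => ?_
    · simp only [Finset.mem_sdiff, Finset.mem_range, not_lt] at hi
      exact Finset.sum_eq_zero fun J _ => by
        rw [nextPart, if_neg (by omega), if_pos (by omega), Nat.cast_zero, zero_mul]
    · rw [Finset.mem_range] at hi
      rw [mul_assoc, ← ih (k - i) (by omega) (k + m - i) (by omega), Finset.mul_sum]
      refine Finset.sum_congr rfl fun J _ => ?_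
      rw [nextPart, if_neg (by omega), if_neg (by omega), show k + 1 - (i + 1) = k - i by omega]
      simp [tailWeight]
      ring

theorem sum_nextPart_mul_weight (k m : ℕ) :
    ∑ I : Composition (k + m + 1), (nextPart I.blocks (k + 1) : R) * weight e I.blocks
      = weightSum e (k + 1) * overshootSum e m 1 := by
  rw [sum_composition_succ (k + m) fun I => (nextPart I (k + 1) : R) * weight e I,
    weightSum_succ, Finset.sum_mul]
  symm
  refine Finset.sum_subset_zero_on_sdiff
    (Finset.range_subset_range.mpr (by omega)) (fun i hi => ?_) fun i hi => ?_
  · simp only [Finset.mem_sdiff, Finset.mem_range, not_lt] at hi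
    exact Finset.sum_eq_zero fun J _ => by
      rw [nextPart, if_neg (by omega), if_pos (by omega), Nat.cast_zero, zero_mul]
  · rw [Finset.mem_range] at hi
    rw [mul_assoc, ← sum_nextPart_mul_tailWeight e (k - i) m (k + m - i) (by omega),
      Finset.mul_sum]
    refine Finset.sum_congr rfl fun J _ => ?_
    rw [nextPart, if_neg (by omega), if_neg (by omega), show k + 1 - (i + 1) = k - i by omega]
    simp [weight]
    ring

theorem overshootSum_self (n : ℕ) : overshootSum e n n = 0 :=
  Finset.sum_eq_zero fun I _ => by
    have h := overshoot_sum I.blocks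
    rw [I.blocks_sum] at h
    rw [h, Nat.cast_zero, zero_mul]

theorem overshootSum_add (k m : ℕ) (hm : 1 ≤ m) :
    overshootSum e (k + m + 1) (k + 1) + weightSum e (k + 1) * overshootSum e m 1
      = overshootSum e (k + m + 1) (k + 2) + weightSum e (k + m + 1) := by
  rw [← sum_nextPart_mul_weight, overshootSum, overshootSum, weightSum, ← Finset.sum_add_distrib,
    ← Finset.sum_add_distrib]
  refine Finset.sum_congr rfl fun I _ => ?_
  have h := congrArg (Nat.cast : ℕ → R) (overshoot_add_nextPart I.blocks (fun i => I.blocks_pos)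
    (k + 1) (by omega) (by rw [I.blocks_sum]; omega))
  push_cast at h
  linear_combination h * weight e I.blocks

end Compositions

section GeneratingFunctions

open scoped PowerSeries

variable {ι R : Type*} [Fintype ι] [CommRing R] (x : ι → R) (e : ℕ → R)

theorem mk_succ_eq (f : ℕ → R) :
    PowerSeries.mk f
      = PowerSeries.C (f 0) + PowerSeries.X * PowerSeries.mk fun k => f (k + 1) := by
  ext n
  cases n <;> simp [PowerSeries.coeff_succ_X_mul, PowerSeries.coeff_succ_C]

theorem mk_mul_mk (f g : ℕ → R) :
    PowerSeries.mk f * PowerSeries.mk g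
      = PowerSeries.mk fun n => ∑ i ∈ Finset.range (n + 1), f i * g (n - i) := by
  ext n
  rw [PowerSeries.coeff_mul, PowerSeries.coeff_mk]
  simpa using Finset.Nat.sum_antidiagonal_eq_sum_range_succ (fun i j => f i * g j) n

theorem derivative_mk (f : ℕ → R) :
    d⁄dX R (PowerSeries.mk f) = PowerSeries.mk fun k => (k + 1) * f (k + 1) := by
  ext n
  simp [PowerSeries.coeff_derivative, mul_comm]

/-- The power series `1 / (1 + y X)`. -/
noncomputable def geom (y : R) : R⟦X⟧ := PowerSeries.mk fun k => (-y) ^ k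

theorem one_add_mul_geom (y : R) : (1 + PowerSeries.X * PowerSeries.C y) * geom y = 1 := by
  have h := mk_succ_eq fun k => (-y) ^ k
  have h' : (PowerSeries.mk fun k => (-y) ^ (k + 1)) = PowerSeries.C (-y) * geom y := by
    ext n; simp [geom, pow_succ']
  rw [h'] at h
  rw [add_mul, one_mul]
  nth_rw 1 [geom, h]
  simp
  ring

theorem derivative_geom (y : R) : d⁄dX R (geom y) = -(PowerSeries.C y * geom y ^ 2) := by
  have h := one_add_mul_geom y
  have h' := congrArg (d⁄dX R) h
  simp only [Derivation.leibniz, smul_eq_mul, map_add, PowerSeries.derivative_X,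
    PowerSeries.derivative_C,
    mul_zero, zero_add, mul_one] at h'
  simp at h'
  linear_combination geom y * h' - d⁄dX R (geom y) * h

theorem mk_ray (i : ι) :
    (PowerSeries.mk fun k => ray x k i) = geom (x i) * PowerSeries.mk (pathSum x) := by
  have h : (1 + PowerSeries.X * PowerSeries.C (x i)) * (PowerSeries.mk fun k => ray x k i)
      = PowerSeries.mk (pathSum x) := by
    rw [mk_succ_eq (pathSum x), add_mul, one_mul]
    nth_rw 1 [mk_succ_eq fun k => ray x k i]
    have : (PowerSeries.mk fun k => pathSum x (k + 1)) = (PowerSeries.mk fun k => ray x (k + 1) i)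
        + PowerSeries.C (x i) * PowerSeries.mk fun k => ray x k i := by
      ext n; simp [ray_succ]
    rw [this]
    simp only [ray.eq_1, pathSum.eq_1]
    ring
  rw [← h]
  linear_combination (-(PowerSeries.mk fun k => ray x k i)) * one_add_mul_geom (x i)

theorem mk_walk (i : ι) :
    (PowerSeries.mk fun k => walk x k i i)
      = geom (x i) * ((PowerSeries.mk fun k => ray x k i) - 1) := by
  have h : (1 + PowerSeries.X * PowerSeries.C (x i)) * (PowerSeries.mk fun k => walk x k i i)
      = (PowerSeries.mk fun k => ray x k i) - 1 := by
    rw [mk_succ_eq fun k => ray x k i, add_mul, one_mul]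
    nth_rw 1 [mk_succ_eq fun k => walk x k i i]
    have : (PowerSeries.mk fun k => walk x (k + 1) i i) = (PowerSeries.mk fun k => ray x (k + 1) i)
        - PowerSeries.C (x i) * PowerSeries.mk fun k => walk x k i i := by
      ext n; simp [walk_succ]
    rw [this]
    simp only [ray.eq_1, walk_zero_self, map_zero, map_one]
    ring
  rw [← h]
  linear_combination (-(PowerSeries.mk fun k => walk x k i i)) * one_add_mul_geom (x i)

/-- The logarithmic derivative `∑ xᵢ X / (1 + xᵢ X)`, up to the factor `X`. -/
noncomputable def logDer : R⟦X⟧ := PowerSeries.X * ∑ i, PowerSeries.C (x i) * geom (x i)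

theorem mk_pathSum_mul : PowerSeries.mk (pathSum x) * (1 - logDer x) = 1 := by
  have h : (PowerSeries.mk fun k => pathSum x (k + 1))
      = ∑ i, PowerSeries.C (x i) * PowerSeries.mk fun k => ray x k i := by
    ext n; simp [pathSum]
  simp only [mk_ray, ← mul_assoc, ← Finset.sum_mul] at h
  have h' := mk_succ_eq (pathSum x)
  rw [h, pathSum.eq_1, map_one] at h'
  rw [logDer]
  linear_combination h'

theorem X_mul_derivative_logDer :
    PowerSeries.X * d⁄dX R (logDer x)
      = PowerSeries.X * ∑ i, PowerSeries.C (x i) * geom (x i) ^ 2 := by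
  simp only [logDer, Derivation.leibniz, smul_eq_mul, PowerSeries.derivative_X,
    PowerSeries.derivative_C, map_sum,
    derivative_geom, mul_zero, add_zero, mul_one, Finset.mul_sum, mul_add]
  refine Finset.sum_congr rfl fun i _ => ?_
  linear_combination (-PowerSeries.X * PowerSeries.C (x i) * geom (x i)) * one_add_mul_geom (x i)

theorem X_mul_mk_tadpoleSum :
    PowerSeries.X * (PowerSeries.mk fun k => tadpoleSum x k 0)
      = PowerSeries.mk (pathSum x) * (PowerSeries.X * d⁄dX R (logDer x)) - logDer x := by
  have h : (PowerSeries.mk fun k => tadpoleSum x k 0)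
      = ∑ i, PowerSeries.C (x i) * PowerSeries.mk fun k => walk x k i i := by
    ext n; simp [tadpoleSum, ray]
  rw [h, X_mul_derivative_logDer, logDer]
  simp only [Finset.mul_sum, ← Finset.sum_sub_distrib]
  refine Finset.sum_congr rfl fun i _ => ?_
  rw [mk_walk, mk_ray]
  ring

variable {x e}

theorem mk_tailSum_mul (h0 : e 0 = 1) :
    PowerSeries.mk (tailSum e) * (PowerSeries.mk e - PowerSeries.X * d⁄dX R (PowerSeries.mk e))
      = 1 := by
  have h := mk_succ_eq (tailSum e)
  have h1 : (PowerSeries.mk fun k => tailSum e (k + 1))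
      = (PowerSeries.mk fun i => i * e (i + 1)) * PowerSeries.mk (tailSum e) := by
    rw [mk_mul_mk]; ext n; simp [tailSum_succ]
  have h2 : PowerSeries.mk e - PowerSeries.X * d⁄dX R (PowerSeries.mk e)
      = 1 - PowerSeries.X * PowerSeries.mk fun i => i * e (i + 1) := by
    rw [derivative_mk]
    nth_rw 1 [mk_succ_eq e]
    rw [h0, map_one, add_sub_assoc, ← mul_sub, ← sub_neg_eq_add, ← mul_neg]
    congr 2
    ext n; simp; ring
  rw [h1, tailSum_zero, map_one] at h
  rw [h2]
  linear_combination h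

theorem mk_weightSum :
    PowerSeries.mk (weightSum e)
      = 1 + PowerSeries.X * d⁄dX R (PowerSeries.mk e) * PowerSeries.mk (tailSum e) := by
  have h1 : (PowerSeries.mk fun k => weightSum e (k + 1))
      = d⁄dX R (PowerSeries.mk e) * PowerSeries.mk (tailSum e) := by
    rw [derivative_mk, mk_mul_mk]; ext n; simp [weightSum_succ]
  rw [mk_succ_eq (weightSum e), h1, weightSum_zero, map_one, mul_assoc]

theorem mk_overshootSum :
    (PowerSeries.mk fun k => overshootSum e (k + 1) 1)
      = PowerSeries.X * d⁄dX R (d⁄dX R (PowerSeries.mk e)) * PowerSeries.mk (tailSum e) := by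
  have h : PowerSeries.X * d⁄dX R (d⁄dX R (PowerSeries.mk e))
      = PowerSeries.mk fun i => i * ((i + 1) * e (i + 1)) := by
    rw [derivative_mk, derivative_mk]
    ext n
    cases n <;> simp [PowerSeries.coeff_succ_X_mul]
  rw [h, mk_mul_mk]
  ext n
  simp [overshootSum_succ_one]

theorem pathSum_eq (h0 : e 0 = 1)
    (hE : logDer x * PowerSeries.mk e = PowerSeries.X * d⁄dX R (PowerSeries.mk e)) (n : ℕ) :
    pathSum x n = weightSum e n := by
  have h : PowerSeries.mk (pathSum x) = PowerSeries.mk (weightSum e) := by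
    rw [mk_weightSum]
    linear_combination (-PowerSeries.mk (pathSum x) + 1) * mk_tailSum_mul h0
      + PowerSeries.mk (tailSum e) * PowerSeries.mk e * mk_pathSum_mul x
      + PowerSeries.mk (tailSum e) * PowerSeries.mk (pathSum x) * hE
  simpa using congrArg (PowerSeries.coeff n) h

theorem tadpoleSum_zero_right (h0 : e 0 = 1)
    (hE : logDer x * PowerSeries.mk e = PowerSeries.X * d⁄dX R (PowerSeries.mk e)) (c : ℕ) :
    tadpoleSum x c 0 = overshootSum e (c + 1) 1 := by
  have hT := X_mul_mk_tadpoleSum x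
  have hP : PowerSeries.mk (pathSum x) = PowerSeries.mk (weightSum e) := by
    ext n; simp [pathSum_eq h0 hE]
  have hM := mk_tailSum_mul h0
  have hE' := congrArg (d⁄dX R) hE
  simp only [Derivation.leibniz, smul_eq_mul, PowerSeries.derivative_X, mul_one] at hE'
  have hPE : PowerSeries.mk (pathSum x) = PowerSeries.mk e * PowerSeries.mk (tailSum e) := by
    rw [hP, mk_weightSum]
    linear_combination -hM
  have h : PowerSeries.mk (fun k => tadpoleSum x k 0)
      = PowerSeries.mk (fun k => overshootSum e (k + 1) 1) := by
    refine PowerSeries.X_mul_cancel ?_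
    rw [hT, mk_overshootSum, hPE]
    linear_combination PowerSeries.X * PowerSeries.mk (tailSum e) * hE'
      + logDer x * hM - PowerSeries.mk (tailSum e) * hE
  simpa using congrArg (PowerSeries.coeff c) h

/-- The tadpole formula. -/
theorem tadpoleSum_eq (h0 : e 0 = 1)
    (hE : logDer x * PowerSeries.mk e = PowerSeries.X * d⁄dX R (PowerSeries.mk e)) (c l : ℕ) :
    tadpoleSum x c l = overshootSum e (c + l + 1) (l + 1) := by
  induction c generalizing l with
  | zero => rw [tadpoleSum_zero_left, zero_add, overshootSum_self]
  | succ c ih =>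
    rw [tadpoleSum_succ, ih (l + 1), pathSum_eq h0 hE, pathSum_eq h0 hE,
      tadpoleSum_zero_right h0 hE]
    have h := overshootSum_add e l (c + 1) (by omega)
    rw [show l + (c + 1) + 1 = c + l + 2 by ring] at h
    rw [show c + 1 + l + 1 = c + l + 2 by ring, show c + (l + 1) + 1 = c + l + 2 by ring]
    linear_combination -h

/-- The clock graph as a sum over compositions. -/
theorem sum_walk_clock_eq (h0 : e 0 = 1)
    (hE : logDer x * PowerSeries.mk e = PowerSeries.X * d⁄dX R (PowerSeries.mk e)) (a b : ℕ) :
    ∑ i, ∑ j, x i * x j * walk x a i j * walk x b i j * walk x 1 i j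
      = overshootSum e (a + b + 3) 2 - overshootSum e (a + b + 3) (b + 2)
        + (∑ k ∈ Finset.range (b + 2), overshootSum e (a + b + 3) (k + 1)
          - ∑ k ∈ Finset.range (b + 2), overshootSum e (a + b + 3) (a + 2 + k)) := by
  have hQ (c d : ℕ) : twoCycleSum x c d
      = ∑ k ∈ Finset.range c, overshootSum e (c + d + 1) (k + 2)
        - ∑ k ∈ Finset.range c, overshootSum e (c + d + 1) (k + d + 2) := by
    induction c generalizing d with
    | zero => simp [twoCycleSum_zero_left]
    | succ c ih =>
      rw [twoCycleSum_succ, ih, tadpoleSum_eq h0 hE, tadpoleSum_eq h0 hE, Finset.sum_range_succ,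
        Finset.sum_range_succ' _ c, show d + (c + 1) + 1 = c + 1 + d + 1 by ring,
        show c + (d + 1) + 1 = c + 1 + d + 1 by ring]
      simp only [zero_add, add_assoc, add_comm, add_left_comm]
      ring
  rw [sum_walk_clock, hQ]
  simp only [tadpoleSum_eq h0 hE]
  rw [show a + b + 1 + 1 + 1 = a + b + 3 by ring, show a + 1 + (b + 1) + 1 = a + b + 3 by ring,
    show a + b + 2 + 0 + 1 = a + b + 3 by ring, show a + (b + 2) + 1 = a + b + 3 by ring]
  generalize overshootSum e (a + b + 3) = f
  have h1 := Finset.sum_range_add (fun k => f (k + 1)) (a + 1) (b + 2)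
  have h2 := Finset.sum_range_add (fun k => f (k + 1)) (b + 2) (a + 1)
  rw [Finset.sum_range_succ' _ a] at h1
  rw [add_comm, h1, Finset.sum_range_succ' _ a] at h2
  have h3 : ∀ k, a + 1 + k + 1 = a + 2 + k := fun k => by ring
  have h4 : ∀ k, b + 2 + (k + 1) + 1 = k + (b + 2) + 2 := fun k => by ring
  simp only [h3, h4] at h2
  linear_combination h2

end GeneratingFunctions

section PartialSums

theorem exists_eq_append_cons (I : List ℕ) (m : ℕ) (h1 : 1 ≤ m) (hm : m ≤ I.sum) :
    ∃ A y B s, I = A ++ y :: B ∧ m = A.sum + s ∧ 1 ≤ s ∧ s ≤ y := by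
  induction I generalizing m with
  | nil => simp at hm; omega
  | cons i t ih =>
    rw [List.sum_cons] at hm
    rcases le_or_gt m i with h | h
    · exact ⟨[], i, t, m, rfl, by simp, h1, h⟩
    · obtain ⟨A, y, B, s, rfl, hs, hs1, hsy⟩ := ih (m - i) (by omega) (by omega)
      exact ⟨i :: A, y, B, s, rfl, by rw [List.sum_cons]; omega, hs1, hsy⟩

theorem overshoot_append (A L : List ℕ) (k : ℕ) (hk : 1 ≤ k) :
    overshoot (A ++ L) (A.sum + k) = overshoot L k := by
  induction A with
  | nil => simp
  | cons i t ih =>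
    rw [List.cons_append, overshoot, List.sum_cons, if_neg (by omega), ← ih]
    congr 1
    omega

theorem sum_range_sub (x s : ℕ) (h : s ≤ x) :
    ∑ k ∈ Finset.range s, (x - (k + 1)) + ∑ k ∈ Finset.range (x - s), k
      = ∑ k ∈ Finset.range x, k := by
  induction s with
  | zero => simp
  | succ s ih =>
    rw [← ih (by omega), Finset.sum_range_succ, show x - s = x - (s + 1) + 1 by omega,
      Finset.sum_range_succ]
    ring

theorem sum_overshoot_prefix (A : List ℕ) (y : ℕ) (B : List ℕ) (s : ℕ) (hs : s ≤ y) :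
    ∑ k ∈ Finset.range (A.sum + s), overshoot (A ++ y :: B) (k + 1)
        + ∑ k ∈ Finset.range (y - s), k
      = (A.map fun i => ∑ k ∈ Finset.range i, k).sum + ∑ k ∈ Finset.range y, k := by
  induction A with
  | nil =>
    simp only [List.sum_nil, zero_add, List.nil_append, List.map_nil]
    rw [← sum_range_sub y s hs]
    congr 1
    refine Finset.sum_congr rfl fun k hk => ?_
    rw [Finset.mem_range] at hk
    rw [overshoot, if_pos (by omega)]
  | cons i t ih =>
    rw [List.map_cons, List.sum_cons, List.sum_cons, add_assoc i, Finset.sum_range_add, add_assoc,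
      add_assoc, ← ih, ← sum_range_sub i i le_rfl]
    simp only [Nat.sub_self, Finset.range_zero, Finset.sum_empty, add_zero]
    congr 1
    · refine Finset.sum_congr rfl fun k hk => ?_
      rw [Finset.mem_range] at hk
      rw [List.cons_append, overshoot, if_pos (by omega)]
    · congr 1
      refine Finset.sum_congr rfl fun k _ => ?_
      rw [List.cons_append, overshoot, if_neg (by omega)]
      congr 1
      omega

theorem sum_overshoot (B : List ℕ) :
    ∑ k ∈ Finset.range B.sum, overshoot B (k + 1)
      = (B.map fun i => ∑ k ∈ Finset.range i, k).sum := by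
  have h := sum_overshoot_prefix B 0 [] 0 le_rfl
  simp only [add_zero, Nat.sub_self, Finset.range_zero, Finset.sum_empty] at h
  rw [← h]
  refine Finset.sum_congr rfl fun k hk => ?_
  rw [Finset.mem_range] at hk
  obtain ⟨A, y, C, s, rfl, hs, hs1, hsy⟩ := exists_eq_append_cons B (k + 1) (by omega) (by omega)
  rw [hs, List.append_assoc, overshoot_append _ _ _ hs1, overshoot_append _ _ _ hs1,
    List.cons_append, overshoot, overshoot, if_pos hsy, if_pos hsy]

theorem sum_overshoot_suffix (A : List ℕ) (y : ℕ) (B : List ℕ) (u : ℕ) (hu : u ≤ y) :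
    ∑ k ∈ Finset.range (B.sum + u), overshoot (A ++ y :: B) (A.sum + (y - u + 1 + k))
      = (B.map fun i => ∑ k ∈ Finset.range i, k).sum + ∑ k ∈ Finset.range u, k := by
  rw [add_comm B.sum, Finset.sum_range_add, add_comm, ← sum_overshoot, ← sum_range_sub u u le_rfl]
  simp only [Nat.sub_self, Finset.range_zero, Finset.sum_empty, add_zero]
  congr 1
  · refine Finset.sum_congr rfl fun k _ => ?_
    rw [overshoot_append _ _ _ (by omega), overshoot, if_neg (by omega)]
    congr 1
    omega
  · refine Finset.sum_congr rfl fun k hk => ?_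
    rw [Finset.mem_range] at hk
    rw [overshoot_append _ _ _ (by omega), overshoot, if_pos (by omega)]
    omega

theorem take_sum_mono (L : List ℕ) : Monotone fun k => (L.take k).sum := fun _ _ h =>
  ((List.take_prefix_take_left h).sublist).sum_le_sum fun _ _ => Nat.zero_le _

theorem drop_sum_anti (L : List ℕ) : Antitone fun k => (L.drop k).sum := fun _ _ h =>
  ((List.drop_suffix_drop_left L h).sublist).sum_le_sum fun _ _ => Nat.zero_le _

theorem take_append_cons_sum (A : List ℕ) (y : ℕ) (B : List ℕ) :
    ((A ++ y :: B).take (A.length + 1)).sum = A.sum + y := by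
  simp [List.take_append, List.take_of_length_le (Nat.le_succ _)]

theorem sInf_take_sum (A : List ℕ) (y : ℕ) (B : List ℕ) (s : ℕ) (h1 : 1 ≤ s) (hs : s ≤ y) :
    sInf {k | A.sum + s ≤ ((A ++ y :: B).take k).sum} = A.length + 1 := by
  refine IsLeast.csInf_eq ⟨?_, fun k hk => ?_⟩
  · rw [Set.mem_ofPred_eq, take_append_cons_sum]
    omega
  · by_contra! h
    have := take_sum_mono (A ++ y :: B) (Nat.lt_succ_iff.mp h)
    simp only [List.take_left'] at this
    rw [Set.mem_ofPred_eq] at hk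
    omega

theorem thetaP_eq (I : List ℕ) (m : ℕ) (h1 : 1 ≤ m) (hm : m ≤ I.sum) :
    thetaP I m = overshoot I m := by
  obtain ⟨A, y, B, s, rfl, rfl, hs1, hsy⟩ := exists_eq_append_cons I m h1 hm
  have h : sigmaP (A ++ y :: B) ((A.sum + s : ℕ) : ℝ) = ((A.sum + y : ℕ) : ℝ) := by
    refine IsLeast.csInf_eq ⟨⟨A.length + 1, by simp, by rw [take_append_cons_sum], ?_⟩, ?_⟩
    · exact_mod_cast Nat.add_le_add_left hsy _
    · rintro _ ⟨k, -, rfl, hk⟩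
      rw [Nat.cast_le] at hk ⊢
      rw [← take_append_cons_sum A y B]
      refine take_sum_mono _ ?_
      by_contra! h
      have := take_sum_mono (A ++ y :: B) (Nat.lt_succ_iff.mp h)
      simp only [List.take_left'] at this
      omega
  rw [thetaP, h, overshoot_append _ _ _ hs1, overshoot, if_pos hsy, Nat.cast_sub hsy]
  push_cast
  ring

theorem sigmaM_reverse_of_le (K : List ℕ) (y : ℕ) (B : List ℕ) (a : ℕ) (hB : B.sum ≤ a)
    (hy : a < y + B.sum) : sigmaM (K ++ y :: B).reverse a = B.sum := by
  have hr : (K ++ y :: B).reverse = B.reverse ++ y :: K.reverse := by simp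
  refine IsGreatest.csSup_eq ⟨⟨B.length, by simp, by simp [hr], by exact_mod_cast hB⟩, ?_⟩
  rintro _ ⟨k, -, rfl, hk⟩
  rw [Nat.cast_le] at hk ⊢
  rw [hr] at hk ⊢
  by_cases h : k ≤ B.reverse.length
  · have := take_sum_mono (B.reverse ++ y :: K.reverse) h
    simpa using this
  · have := take_sum_mono (B.reverse ++ y :: K.reverse) (Nat.lt_of_not_le h)
    simp only [Nat.succ_eq_add_one, take_append_cons_sum, List.sum_reverse] at this
    omega

theorem sigmaM_reverse_of_eq (K B : List ℕ) (a : ℕ) (hB : B.sum = a) :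
    sigmaM (K ++ B).reverse a = a := by
  refine IsGreatest.csSup_eq ⟨⟨B.length, by simp, by simp [hB], le_rfl⟩, ?_⟩
  rintro _ ⟨k, -, rfl, hk⟩
  exact hk

theorem exists_phi_eq (a : ℕ) (I : List ℕ) : ∃ K, phi a I = K ++ I.drop (kPhi a I) := by
  unfold phi
  split_ifs with h
  · exact ⟨[], by simp [h]⟩
  · exact ⟨_, rfl⟩

theorem thetaM_reverse_phi (I : List ℕ) (a m : ℕ) (h1 : 1 ≤ m) (hm : a + m = I.sum) :
    thetaM (phi a I).reverse a = overshoot I m := by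
  obtain ⟨A, y, B, s, rfl, rfl, hs1, hsy⟩ := exists_eq_append_cons I m h1 (by omega)
  simp only [List.sum_append, List.sum_cons] at hm
  obtain ⟨K, hK⟩ := exists_phi_eq a (A ++ y :: B)
  have hdA : (A ++ y :: B).drop A.length = y :: B := by simp
  have hdB : (A ++ y :: B).drop (A.length + 1) = B := by simp [List.drop_append]
  have hbdd : BddAbove {j | j ≤ (A ++ y :: B).length ∧ a ≤ ((A ++ y :: B).drop j).sum} :=
    ⟨_, fun j hj => hj.1⟩
  have hne : {j | j ≤ (A ++ y :: B).length ∧ a ≤ ((A ++ y :: B).drop j).sum}.Nonempty :=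
    ⟨A.length, by simp, by rw [hdA, List.sum_cons]; omega⟩
  have hmem := Nat.sSup_mem hne hbdd
  rw [overshoot_append _ _ _ hs1, overshoot, if_pos hsy, thetaM, hK]
  rcases eq_or_ne B.sum a with hB | hB
  · have hk : A.length + 1 ≤ kPhi a (A ++ y :: B) :=
      le_csSup hbdd ⟨by simp, by rw [hdB, hB]⟩
    have h := drop_sum_anti (A ++ y :: B) hk
    simp only [hdB] at h
    have hge : a ≤ ((A ++ y :: B).drop (kPhi a (A ++ y :: B))).sum := hmem.2
    rw [sigmaM_reverse_of_eq _ _ _ (by omega), show y - s = 0 by omega]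
    simp
  · have hk : kPhi a (A ++ y :: B) = A.length := by
      refine IsGreatest.csSup_eq ⟨⟨by simp, by rw [hdA, List.sum_cons]; omega⟩, fun j hj => ?_⟩
      by_contra! h
      have := drop_sum_anti (A ++ y :: B) (Nat.succ_le_of_lt h)
      simp only [Nat.succ_eq_add_one, hdB] at this
      have := hj.2
      omega
    rw [hk, hdA, sigmaM_reverse_of_le _ _ _ _ (by omega) (by omega), Nat.cast_sub hsy]
    have : (a : ℝ) + s = y + B.sum := by exact_mod_cast (by omega : a + s = y + B.sum)
    linarith

theorem sum_range_list_sum (l : List ℕ) :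
    ((∑ k ∈ Finset.range l.sum, k : ℕ) : ℤ)
      = ((l.map fun i => ∑ k ∈ Finset.range i, k).sum : ℕ) + e2 l := by
  induction l with
  | nil => simp [e2]
  | cons i t ih =>
    rw [List.sum_cons, Finset.sum_range_add, Finset.sum_add_distrib, List.map_cons, List.sum_cons,
      e2]
    push_cast at ih ⊢
    rw [ih]
    simp
    ring

theorem DeltaI_eq (I A B A' B' : List ℕ) (m s y t y' : ℕ) (hI : I = A ++ y :: B)
    (hI' : I.tail ++ I.take 1 = A' ++ y' :: B') (hs : m = A.sum + s) (ht : m = A'.sum + t)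
    (hs1 : 1 ≤ s) (hsy : s ≤ y) (ht1 : 1 ≤ t) (hty : t ≤ y') :
    DeltaI I m = if I.headI ≤ y - s then (s : ℤ) * (y - s - I.headI)
      else e2 ((y - s) :: (B.take (A'.length - A.length) ++ [t])) := by
  have hp : pIdx I m = A.length + 1 := by
    rw [pIdx, hI, hs, sInf_take_sum A y B s hs1 hsy]
  have hq : qIdx I m = A'.length + 1 := by
    rw [qIdx, hI', ht, sInf_take_sum A' y' B' t ht1 hty]
  have hsV : sVal I m = s := by
    rw [sVal, hp, hI, hs]; simp
  have htV : tVal I m = t := by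
    rw [tVal, hq, hI', ht]; simp
  have hip : ipPart I m = y := by
    rw [ipPart, hp, hI]; simp
  have hd : I.drop (A.length + 1) = B := by rw [hI]; simp [List.drop_append]
  rw [DeltaI, hp, hq, hsV, htV, hip, hd, Nat.add_sub_add_right]
  refine if_congr ?_ rfl rfl
  rw [← Nat.cast_sub hsy, Nat.cast_le]

/-- Reversal of all parts but the first. -/
def reverseTail : List ℕ → List ℕ
  | [] => []
  | i :: t => i :: t.reverse

/-- `Δ_I(m)` as a difference of sums of `Θ⁺`. -/
theorem DeltaI_eq_sum (I : List ℕ) (m n : ℕ) (h1 : 1 ≤ m) (hmn : m ≤ n) (hn : I.sum = n) :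
    DeltaI I m = ((∑ k ∈ Finset.range m, overshoot I (k + 1) : ℕ) : ℤ)
      - (∑ k ∈ Finset.range m, overshoot (reverseTail I) (n - m + 1 + k) : ℕ) := by
  have second (A : List ℕ) (y : ℕ) (B : List ℕ) (t : ℕ)
      (h : I.tail ++ I.take 1 = A ++ y :: B) (ht : m = A.sum + t) (hty : t ≤ y) :
      ∑ k ∈ Finset.range m, overshoot (reverseTail I) (n - m + 1 + k)
        = (A.map fun i => ∑ k ∈ Finset.range i, k).sum + ∑ k ∈ Finset.range t, k := by
    have hr : reverseTail I = B.reverse ++ y :: A.reverse := by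
      have := congrArg List.reverse h
      cases I
      · simp at this
      · simpa [reverseTail] using this
    have hsum : n = A.sum + y + B.sum := by
      have := congrArg List.sum h
      cases I <;> simp at this hn <;> omega
    have h := sum_overshoot_suffix B.reverse y A.reverse t hty
    rw [List.map_reverse, List.sum_reverse, List.sum_reverse, List.sum_reverse, ← ht, ← hr] at h
    rw [← h]
    refine Finset.sum_congr rfl fun k _ => ?_
    congr 1
    omega
  obtain ⟨A, y, B, s, hI, hs, hs1, hsy⟩ := exists_eq_append_cons I m h1 (by omega)
  have first := sum_overshoot_prefix A y B s hsy
  rw [← hI, ← hs] at first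
  have tri_add (u v : ℕ) : ∑ k ∈ Finset.range (u + v), k
      = ∑ k ∈ Finset.range u, k + ∑ k ∈ Finset.range v, k + u * v := by
    rw [Finset.sum_range_add, Finset.sum_add_distrib]
    simp
    ring
  cases A with
  | nil =>
    obtain ⟨A', y', B', t, hI', ht, ht1, hty⟩ := exists_eq_append_cons (B ++ [y]) m h1
      (by simp [hI] at hn; simp; omega)
    have hlen : A'.length ≤ B.length := by
      have := congrArg List.length hI'
      simp at this
      omega
    have hA' : B.take A'.length = A' := by
      have := congrArg (List.take A'.length) hI'
      rwa [List.take_append_of_le_length hlen, List.take_left'] at this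
      rfl
    have hI2 : I.tail ++ I.take 1 = A' ++ y' :: B' := by rw [hI, ← hI']; simp
    rw [DeltaI_eq I [] B A' B' m s y t y' hI hI2 hs ht hs1 hsy ht1 hty, if_neg (by
        rw [hI]; simp; omega), second A' y' B' t hI2 ht hty]
    simp only [List.length_nil, Nat.sub_zero, hA']
    have h := sum_range_list_sum ((y - s) :: (A' ++ [t]))
    rw [show ((y - s) :: (A' ++ [t])).sum = y by simp at hs ⊢; omega] at h
    simp only [List.map_cons, List.map_append, List.map_nil, List.sum_cons, List.sum_append,
      List.sum_nil, add_zero, zero_add] at h first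
    push_cast at h ⊢
    zify at first
    linarith
  | cons i A =>
    simp only [List.sum_cons] at hs
    have hh : I.headI = i := by rw [hI]; rfl
    have hJ : I.tail ++ I.take 1 = A ++ y :: (B ++ [i]) := by rw [hI]; simp
    by_cases hle : i + s ≤ y
    · rw [DeltaI_eq I (i :: A) B A (B ++ [i]) m s y (i + s) y hI hJ (by simpa using hs) (by omega)
        hs1 hsy (by omega) hle, if_pos (by rw [hh]; omega), second A y _ (i + s) hJ (by omega) hle,
        hh]
      obtain ⟨r, rfl⟩ := Nat.exists_eq_add_of_le hle
      rw [tri_add (i + s) r, tri_add i s, show i + s + r - s = i + r by omega, tri_add i r] at first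
      rw [tri_add i s]
      simp only [List.map_cons, List.sum_cons] at first
      zify at first
      push_cast
      linear_combination -first
    · obtain ⟨A', y', B', t, hI', ht, ht1, hty⟩ := exists_eq_append_cons (B ++ [i]) (i + s - y)
        (by omega) (by simp; omega)
      have hlen : A'.length ≤ B.length := by
        have := congrArg List.length hI'
        simp at this
        omega
      have hA' : B.take A'.length = A' := by
        have := congrArg (List.take A'.length) hI'
        rwa [List.take_append_of_le_length hlen, List.take_left'] at this
        rfl
      have hJ2 : I.tail ++ I.take 1 = (A ++ y :: A') ++ y' :: B' := by rw [hJ, hI']; simp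
      have ht2 : m = (A ++ y :: A').sum + t := by simp; omega
      rw [DeltaI_eq I (i :: A) B (A ++ y :: A') B' m s y t y' hI hJ2 (by simpa using hs) ht2
        hs1 hsy ht1 hty, if_neg (by rw [hh]; omega), second _ _ _ _ hJ2 ht2 hty]
      rw [show (A ++ y :: A').length - (i :: A).length = A'.length by simp; omega, hA']
      have h := sum_range_list_sum ((y - s) :: (A' ++ [t]))
      rw [show ((y - s) :: (A' ++ [t])).sum = i by simp; omega] at h
      simp only [List.map_cons, List.map_append, List.map_nil, List.sum_cons, List.sum_append,
        List.sum_nil, add_zero] at h first ⊢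
      push_cast at h ⊢
      zify at first
      linarith

end PartialSums

section ClockCoefficients

variable {R : Type*} [CommRing R] (e : ℕ → R)

theorem sum_composition_reverse {M : Type*} [AddCommMonoid M] (n : ℕ) (F : List ℕ → M) :
    ∑ I : Composition n, F I.blocks.reverse = ∑ I : Composition n, F I.blocks :=
  Equiv.sum_comp Composition.reverse_involutive.toPerm fun I : Composition n => F I.blocks

theorem sum_reverseTail (n : ℕ) (F : List ℕ → R) :
    ∑ I : Composition n, F (reverseTail I.blocks) * weight e I.blocks
      = ∑ I : Composition n, F I.blocks * weight e I.blocks := by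
  cases n with
  | zero =>
    rw [sum_composition_zero fun I => F (reverseTail I) * weight e I,
      sum_composition_zero fun I => F I * weight e I]
    rfl
  | succ n =>
    rw [sum_composition_succ n fun I => F (reverseTail I) * weight e I,
      sum_composition_succ n fun I => F I * weight e I]
    refine Finset.sum_congr rfl fun i _ => ?_
    rw [← sum_composition_reverse _ fun J => F ((i + 1) :: J) * weight e ((i + 1) :: J)]
    refine Finset.sum_congr rfl fun J _ => ?_
    simp only [reverseTail, weight, tailWeight, List.map_reverse, List.prod_reverse]

theorem sum_DeltaI (m n : ℕ) (h1 : 1 ≤ m) (hmn : m ≤ n) :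
    ∑ I : Composition n, (DeltaI I.blocks m : R) * weight e I.blocks
      = ∑ k ∈ Finset.range m, overshootSum e n (k + 1)
        - ∑ k ∈ Finset.range m, overshootSum e n (n - m + 1 + k) := by
  have h (I : Composition n) : (DeltaI I.blocks m : R) * weight e I.blocks
      = ∑ k ∈ Finset.range m, (overshoot I.blocks (k + 1) : R) * weight e I.blocks
        - ∑ k ∈ Finset.range m,
          (overshoot (reverseTail I.blocks) (n - m + 1 + k) : R) * weight e I.blocks := by
    rw [DeltaI_eq_sum _ m n h1 hmn I.blocks_sum, ← Finset.sum_mul, ← Finset.sum_mul]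
    push_cast
    ring
  simp only [h, Finset.sum_sub_distrib]
  rw [Finset.sum_comm, Finset.sum_comm (s := Finset.univ)]
  congr 1
  refine Finset.sum_congr rfl fun k _ => ?_
  exact sum_reverseTail e n fun I => (overshoot I (n - m + 1 + k) : R)

theorem DI_eq (a b : ℕ) (hb : 1 ≤ b) (I : List ℕ) (hI : I.sum = a + b + 1) :
    DI a b I = overshoot I 2 - overshoot I (b + 1) + DeltaI I (b + 1) := by
  have h := thetaP_eq I 2 (by omega) (by omega)
  rw [Nat.cast_ofNat] at h
  rw [DI, h, thetaM_reverse_phi I a (b + 1) (by omega) (by omega)]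

variable (N : ℕ)

theorem wI_mul_eComp (I : List ℕ) :
    C (wI I : ℝ) * eComp N I = weight (esymm (Fin N) ℝ) I := by
  cases I with
  | nil => simp [wI, eComp, weight]
  | cons i t =>
    have h : C (((t.map (· - 1)).prod : ℕ) : ℝ) * eComp N t
        = tailWeight (esymm (Fin N) ℝ) t := by
      rw [eComp, tailWeight, List.prod_map_mul]
      simp [Nat.cast_list_prod, map_list_prod, Function.comp_def]
    rw [weight, ← h, wI, eComp, List.map_cons, List.prod_cons, ← eComp]
    push_cast
    simp
    ring

/-- Newton's identities in generating function form. -/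
theorem logDer_mul_mk_esymm :
    logDer (MvPolynomial.X : Fin N → MvPolynomial (Fin N) ℝ) * PowerSeries.mk (esymm (Fin N) ℝ)
      = PowerSeries.X * PowerSeries.derivative (MvPolynomial (Fin N) ℝ)
          (PowerSeries.mk (esymm (Fin N) ℝ)) := by
  rw [logDer, mul_assoc]
  congr 1
  ext k : 1
  have hc (m : ℕ) : PowerSeries.coeff m (∑ i : Fin N, PowerSeries.C (MvPolynomial.X i)
      * geom (MvPolynomial.X i : MvPolynomial (Fin N) ℝ)) = (-1) ^ m * psum (Fin N) ℝ (m + 1) := by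
    rw [map_sum, psum, Finset.mul_sum]
    refine Finset.sum_congr rfl fun i _ => ?_
    rw [PowerSeries.coeff_C_mul, geom, PowerSeries.coeff_mk, neg_pow]
    ring
  have h := MvPolynomial.mul_esymm_eq_sum (Fin N) ℝ (k + 1)
  rw [Finset.sum_filter, Finset.Nat.sum_antidiagonal_succ', if_neg (lt_irrefl _), zero_add,
    Finset.mul_sum] at h
  rw [PowerSeries.coeff_mul, PowerSeries.coeff_derivative, PowerSeries.coeff_mk, mul_comm]
  push_cast at h
  rw [mul_comm, mul_comm _ ((k : MvPolynomial (Fin N) ℝ) + 1), h,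
    ← Finset.Nat.sum_antidiagonal_swap]
  refine Finset.sum_congr rfl fun p hp => ?_
  rw [Finset.HasAntidiagonal.mem_antidiagonal] at hp
  rw [if_pos (by omega), Prod.fst_swap, Prod.snd_swap, hc, PowerSeries.coeff_mk, ← hp]
  have h1 : ((-1 : MvPolynomial (Fin N) ℝ) ^ p.1) * (-1) ^ p.1 = 1 := by
    rw [← mul_pow]; simp
  linear_combination (-(-1) ^ p.2 * psum (Fin N) ℝ (p.2 + 1) * esymm (Fin N) ℝ p.1) * h1

theorem sum_DI_mul (a b : ℕ) (hb : 1 ≤ b) (hba : b ≤ a) :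
    ∑ I : Composition (a + b + 1), C (DI a b I.blocks) * C (wI I.blocks : ℝ) * eComp N I.blocks
      = ∑ i, ∑ j, X i * X j * walk X (a - 1) i j * walk X (b - 1) i j * walk X 1 i j := by
  obtain ⟨b, rfl⟩ := Nat.exists_eq_add_of_le' hb
  obtain ⟨a, rfl⟩ := Nat.exists_eq_add_of_le' (hb.trans hba)
  have h (I : Composition (a + 1 + (b + 1) + 1)) :
      C (DI (a + 1) (b + 1) I.blocks) * C (wI I.blocks : ℝ) * eComp N I.blocks
        = (overshoot I.blocks 2 : MvPolynomial (Fin N) ℝ) * weight (esymm (Fin N) ℝ) I.blocks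
          - (overshoot I.blocks (b + 2) : MvPolynomial (Fin N) ℝ)
              * weight (esymm (Fin N) ℝ) I.blocks
          + (DeltaI I.blocks (b + 2) : MvPolynomial (Fin N) ℝ)
              * weight (esymm (Fin N) ℝ) I.blocks := by
    rw [mul_assoc, wI_mul_eComp, DI_eq _ _ hb _ I.blocks_sum]
    simp
    ring
  simp only [h]
  rw [Finset.sum_add_distrib, Finset.sum_sub_distrib, sum_DeltaI _ _ _ (by omega) (by omega)]
  rw [Nat.add_sub_cancel, Nat.add_sub_cancel,
    sum_walk_clock_eq (by simp) (logDer_mul_mk_esymm N) a b,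
    show a + 1 + (b + 1) + 1 - (b + 2) + 1 = a + 2 by omega,
    show a + 1 + (b + 1) + 1 = a + b + 3 by omega]
  rfl

end ClockCoefficients

section Colorings

theorem forall_mem_chainE {r : ℕ → ℕ → Prop} (l : List ℕ) :
    (∀ p ∈ chainE l, r p.1 p.2) ↔ l.IsChain r := by
  induction l with
  | nil => simp [chainE]
  | cons i t ih =>
    cases t with
    | nil => simp [chainE]
    | cons j t =>
      rw [List.isChain_cons_cons, ← ih]
      simp [chainE]

theorem forall_adj_graphOfEdges {n : ℕ} [NeZero n] {E : List (ℕ × ℕ)}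
    (hE : ∀ p ∈ E, p.1 < p.2 ∧ p.2 < n) {M : Type*} (κ : Fin n → M) :
    (∀ u v, (graphOfEdges n E).Adj u v → κ u ≠ κ v)
      ↔ ∀ p ∈ E, κ (Fin.ofNat n p.1) ≠ κ (Fin.ofNat n p.2) := by
  constructor
  · intro h p hp
    obtain ⟨h1, h2⟩ := hE p hp
    refine h _ _ ?_
    rw [graphOfEdges, SimpleGraph.fromRel_adj]
    have h3 : ((Fin.ofNat n p.1 : Fin n) : ℕ) = p.1 := Nat.mod_eq_of_lt (h1.trans h2)
    have h4 : ((Fin.ofNat n p.2 : Fin n) : ℕ) = p.2 := Nat.mod_eq_of_lt h2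
    rw [h3, h4, Ne, Fin.ext_iff, h3, h4]
    exact ⟨h1.ne, Or.inl hp⟩
  · intro h u v huv
    rw [graphOfEdges, SimpleGraph.fromRel_adj] at huv
    have hu : Fin.ofNat n u = u := Fin.ext (Nat.mod_eq_of_lt u.2)
    have hv : Fin.ofNat n v = v := Fin.ext (Nat.mod_eq_of_lt v.2)
    rcases huv.2 with h' | h'
    · simpa [hu, hv] using h _ h'
    · simpa [hu, hv] using (h _ h').symm

theorem forall_mem_chainE_path {n s k t : ℕ} (hs : 1 ≤ s) (hk : s + k ≤ t) (ht : t < n) :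
    ∀ p ∈ chainE (0 :: ((List.range k).map (· + s) ++ [t])), p.1 < p.2 ∧ p.2 < n := by
  have h : (0 :: ((List.range k).map (· + s) ++ [t])).Pairwise fun u v => u < v ∧ v < n := by
    simp only [List.pairwise_cons, List.pairwise_append, List.pairwise_map, List.mem_append,
      List.mem_map, List.mem_range, List.mem_singleton]
    refine ⟨?_, ?_, by simp, ?_⟩
    · rintro _ (⟨a, ha, rfl⟩ | rfl) <;> omega
    · refine (List.pairwise_lt_range (n := k)).imp_of_mem fun {u v} _ hv huv => ?_
      rw [List.mem_range] at hv
      omega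
    · rintro _ ⟨a, ha, rfl⟩ _ rfl
      omega
  exact (forall_mem_chainE _).mpr h.isChain

theorem sum_fin_cons {M ι : Type*} [AddCommMonoid M] [Fintype ι] (k : ℕ)
    (F : (Fin (k + 1) → ι) → M) : ∑ α, F α = ∑ i, ∑ β : Fin k → ι, F (Fin.cons i β) := by
  rw [← (Fin.consEquiv fun _ : Fin (k + 1) => ι).sum_comp, Fintype.sum_prod_type]
  rfl

theorem sum_fin_snoc {M ι : Type*} [AddCommMonoid M] [Fintype ι] (k : ℕ)
    (F : (Fin (k + 1) → ι) → M) :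
    ∑ α, F α = ∑ i, ∑ β : Fin k → ι, F (Fin.snoc β i) := by
  rw [← (Fin.snocEquiv fun _ : Fin (k + 1) => ι).sum_comp, Fintype.sum_prod_type]
  rfl

theorem sum_fin_append {M ι : Type*} [AddCommMonoid M] [Fintype ι] (k l : ℕ)
    (F : (Fin (k + l) → ι) → M) :
    ∑ α, F α = ∑ β : Fin k → ι, ∑ γ : Fin l → ι, F (Fin.append β γ) := by
  rw [← (Fin.appendEquiv k l).sum_comp, Fintype.sum_prod_type]
  rfl

variable {R ι : Type*} [CommRing R] [Fintype ι] (x : ι → R)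

theorem walk_eq_sum (k : ℕ) (i j : ι) :
    walk x k i j = ∑ α : Fin k → ι,
      if (i :: (List.ofFn α ++ [j])).IsChain (· ≠ ·) then ∏ l, x (α l) else 0 := by
  induction k generalizing i with
  | zero => simp [walk]
  | succ k ih =>
    have h (l : ι) : ∑ β : Fin k → ι,
        (if (i :: (List.ofFn (Fin.cons l β : Fin (k + 1) → ι) ++ [j])).IsChain (· ≠ ·)
          then ∏ m, x ((Fin.cons l β : Fin (k + 1) → ι) m) else 0)
        = x l * walk x k l j - if i = l then x l * walk x k l j else 0 := by
      rw [ih l, Finset.mul_sum]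
      simp only [List.ofFn_cons, List.cons_append, List.isChain_cons_cons, Fin.prod_univ_succ,
        Fin.cons_zero, Fin.cons_succ]
      split_ifs with hil <;> simp [hil]
    rw [sum_fin_cons, Finset.sum_congr rfl fun l _ => h l, Finset.sum_sub_distrib,
      Finset.sum_ite_eq, if_pos (Finset.mem_univ _), walk]

theorem walk_one (i j : ι) :
    walk x 1 i j = ∑ l, if [i, l, j].IsChain (· ≠ ·) then x l else 0 := by
  rw [walk_eq_sum, ← (Equiv.funUnique (Fin 1) ι).symm.sum_comp]
  simp [Equiv.funUnique]

theorem csf_graphOfEdges {n : ℕ} [NeZero n] {E : List (ℕ × ℕ)}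
    (hE : ∀ p ∈ E, p.1 < p.2 ∧ p.2 < n) (N : ℕ) :
    csf (graphOfEdges n E) N = ∑ κ : Fin n → Fin N,
      if ∀ p ∈ E, κ (Fin.ofNat n p.1) ≠ κ (Fin.ofNat n p.2) then ∏ v, X (κ v) else 0 := by
  rw [csf]
  exact Finset.sum_congr (by ext; simp) fun κ _ => by simp only [forall_adj_graphOfEdges hE]

theorem forall_mem_chainE_ne {M : Type*} (f : ℕ → M) (l : List ℕ) :
    (∀ p ∈ chainE l, f p.1 ≠ f p.2) ↔ (l.map f).IsChain (· ≠ ·) := by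
  rw [List.isChain_map, ← forall_mem_chainE]

theorem map_range_eq_ofFn {M : Type*} (f : ℕ → M) (k s : ℕ) (α : Fin k → M)
    (h : ∀ l : Fin k, f (l + s) = α l) :
    ((List.range k).map (· + s)).map f = List.ofFn α := by
  refine List.ext_getElem (by simp) fun l h1 h2 => ?_
  simpa using h ⟨l, by simpa using h2⟩

/-- The chromatic symmetric function of the clock graph, by the colors of its branch vertices. -/
theorem csf_thetaG (a b N : ℕ) :
    csf (thetaG (a + 1) (b + 1) 2) N
      = ∑ i, ∑ j, X i * X j * walk X a i j * walk X b i j * walk X 1 i j := by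
  have h (n : ℕ) (hn : n = a + b + 1 + 1 + 1) : csf (graphOfEdges n
    (chainE (0 :: ((List.range a).map (· + 1) ++ [a + b + 2])) ++
     chainE (0 :: ((List.range b).map (· + (a + 1)) ++ [a + b + 2])) ++
     chainE (0 :: ((List.range 1).map (· + (a + b + 1)) ++ [a + b + 2])))) N
      = ∑ i, ∑ j, X i * X j * walk X a i j * walk X b i j * walk X 1 i j := by
    subst hn
    rw [csf_graphOfEdges, sum_fin_cons]
    · refine Finset.sum_congr rfl fun i _ => ?_
      rw [sum_fin_snoc]
      refine Finset.sum_congr rfl fun j _ => ?_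
      rw [sum_fin_snoc, walk_one, Finset.mul_sum]
      refine Finset.sum_congr rfl fun m _ => ?_
      rw [sum_fin_append, mul_assoc (X i * X j), walk_eq_sum, walk_eq_sum, Finset.sum_mul_sum,
        Finset.mul_sum, Finset.sum_mul]
      refine Finset.sum_congr rfl fun α _ => ?_
      rw [Finset.mul_sum, Finset.sum_mul]
      refine Finset.sum_congr rfl fun β _ => ?_
      set κ : Fin (a + b + 1 + 1 + 1) → Fin N :=
        Fin.cons i (Fin.snoc (Fin.snoc (Fin.append α β) m) j) with hκ
      set f : ℕ → Fin N := fun k => κ (Fin.ofNat _ k) with hf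
      have f_eq {k : ℕ} (v : Fin (a + b + 1 + 1 + 1)) (hv : (v : ℕ) = k) : f k = κ v := by
        exact congrArg κ (Fin.ext (by rw [← hv]; exact Nat.mod_eq_of_lt v.2))
      have f0 : f 0 = i := by rw [f_eq 0 (Fin.val_zero _), hκ, Fin.cons_zero]
      have fj : f (a + b + 2) = j := by
        rw [f_eq (Fin.last _).succ (by simp), hκ, Fin.cons_succ, Fin.snoc_last]
      have fm : f (a + b + 1) = m := by
        rw [f_eq (Fin.last _).castSucc.succ (by simp), hκ, Fin.cons_succ, Fin.snoc_castSucc,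
          Fin.snoc_last]
      have fα (l : Fin a) : f (l + 1) = α l := by
        rw [f_eq (Fin.castAdd b l).castSucc.castSucc.succ (by simp), hκ, Fin.cons_succ,
          Fin.snoc_castSucc, Fin.snoc_castSucc, Fin.append_left]
      have fβ (l : Fin b) : f (l + (a + 1)) = β l := by
        rw [f_eq (Fin.natAdd a l).castSucc.castSucc.succ (by simp; omega), hκ, Fin.cons_succ,
          Fin.snoc_castSucc, Fin.snoc_castSucc, Fin.append_right]
      have hprod : ∏ v, (X (κ v) : MvPolynomial (Fin N) ℝ)
          = X i * X j * ((∏ l, X (α l)) * ∏ l, X (β l)) * X m := by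
        rw [hκ, Fin.prod_univ_succ, Fin.prod_univ_castSucc, Fin.prod_univ_castSucc,
          Fin.prod_univ_add]
        simp only [Fin.cons_zero, Fin.cons_succ, Fin.snoc_castSucc, Fin.snoc_last,
          Fin.append_left, Fin.append_right]
        ring
      have hiff : (∀ p ∈ chainE (0 :: ((List.range a).map (· + 1) ++ [a + b + 2])) ++
            chainE (0 :: ((List.range b).map (· + (a + 1)) ++ [a + b + 2])) ++
            chainE (0 :: ((List.range 1).map (· + (a + b + 1)) ++ [a + b + 2])),
          f p.1 ≠ f p.2) ↔ ((i :: (List.ofFn α ++ [j])).IsChain (· ≠ ·)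
            ∧ (i :: (List.ofFn β ++ [j])).IsChain (· ≠ ·)) ∧ [i, m, j].IsChain (· ≠ ·) := by
        simp only [List.forall_mem_append, forall_mem_chainE_ne]
        simp only [List.map_cons, List.map_append, map_range_eq_ofFn f a 1 α fα,
          map_range_eq_ofFn f b (a + 1) β fβ, f0, fj, List.map_nil]
        simp [fm]
      rw [hprod, if_congr hiff rfl rfl]
      split_ifs <;> simp_all
    · simp only [List.forall_mem_append]
      exact ⟨⟨forall_mem_chainE_path le_rfl (by omega) (by omega),
        forall_mem_chainE_path (by omega) (by omega) (by omega)⟩,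
        forall_mem_chainE_path (by omega) (by omega) (by omega)⟩
  rw [← h (a + 1 + (b + 1) + 2 - 1) (by omega), thetaG]
  simp only [show a + 1 + (b + 1) + 2 - 2 = a + b + 2 by omega,
    show a + 1 + (b + 1) - 1 = a + b + 1 by omega, Nat.add_one_sub_one]

end Colorings

end Clock

/-- `X_{θ_{ab2}} = Σ_{I ⊨ n} D_I w_I e_I`, where
`D_I = Θ⁺_I(2) − Θ⁻_{reverse(φ(I))}(a) + Δ_I(b+1)`. -/
theorem stmt9 (a b n : ℕ) (h2 : 2 ≤ b) (hba : b ≤ a) (hn : n = a + b + 1) (N : ℕ) :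
    csf (thetaG a b 2) N
      = ∑ I : Composition n,
          MvPolynomial.C (DI a b I.blocks) * MvPolynomial.C (wI I.blocks : ℝ)
            * eComp N I.blocks := by
  subst hn
  rw [Clock.sum_DI_mul N a b (by omega) hba, ← Clock.csf_thetaG, Nat.sub_add_cancel (by omega),
    Nat.sub_add_cancel (by omega)]
end

section
/- For every a ≥ b ≥ 2, the clock graph θ_{ab2} is e-positive; that is, all coefficients in the expansion of its chromatic symmetric function X_{θ_{ab2}} in the basis of elementary symmetric functions {e_λ} are nonnegative. -/
open scoped Classical
open MvPolynomial Finset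

section Algebra

variable {S : Type*} [CommRing S]

/-- The coefficients of `1 / (1 - ∑ (k - 1) e_k z ^ k)`. -/
def hSeq (e : ℕ → S) : ℕ → S
  | 0 => 1
  | n + 1 => ∑ i : Fin (n + 1), (i : S) * e (i + 1) * hSeq e (n - i)

/-- The convolution of `u` with `hSeq e`. -/
def hConv (e u : ℕ → S) (n : ℕ) : S := ∑ k ∈ range (n + 1), u k * hSeq e (n - k)

lemma hSeq_zero (e : ℕ → S) : hSeq e 0 = 1 := by rw [hSeq]

lemma hSeq_succ (e : ℕ → S) (n : ℕ) :
    hSeq e (n + 1) = hConv e (fun k => (k : S) * e (k + 1)) n := by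
  rw [hSeq, hConv, ← Fin.sum_univ_eq_sum_range
    (fun k => (k : S) * e (k + 1) * hSeq e (n - k)) (n + 1)]

lemma hConv_zero (e u : ℕ → S) : hConv e u 0 = u 0 := by simp [hConv, hSeq_zero]

lemma hConv_succ (e u : ℕ → S) (n : ℕ) :
    hConv e u (n + 1) = u 0 * hSeq e (n + 1) + hConv e (fun k => u (k + 1)) n := by
  rw [hConv, sum_range_succ', hConv]
  simp [add_comm]

lemma hConv_add (e u v : ℕ → S) (n : ℕ) :
    hConv e u n + hConv e v n = hConv e (fun k => u k + v k) n := by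
  simp [hConv, add_mul, sum_add_distrib]

lemma hConv_sub (e u v : ℕ → S) (n : ℕ) :
    hConv e u n - hConv e v n = hConv e (fun k => u k - v k) n := by
  simp [hConv, sub_mul, sum_sub_distrib]

lemma mul_hConv (e u : ℕ → S) (x : S) (n : ℕ) :
    x * hConv e u n = hConv e (fun k => x * u k) n := by
  simp [hConv, mul_sum, mul_assoc]

lemma sum_hConv {ι : Type*} (s : Finset ι) (e : ℕ → S) (u : ι → ℕ → S) (n : ℕ) :
    ∑ i ∈ s, hConv e (u i) n = hConv e (fun k => ∑ i ∈ s, u i k) n := by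
  simp only [hConv, sum_mul]
  exact sum_comm

lemma map_hSeq {T : Type*} [CommRing T] (f : S →+* T) (e : ℕ → S) (n : ℕ) :
    f (hSeq e n) = hSeq (fun k => f (e k)) n := by
  induction n using Nat.strong_induction_on with
  | _ n ih =>
    cases n with
    | zero => simp [hSeq]
    | succ n =>
      rw [hSeq, hSeq, map_sum]
      refine sum_congr rfl fun i _ => ?_
      rw [map_mul, map_mul, map_natCast, ih _ (by omega)]

lemma map_hConv {T : Type*} [CommRing T] (f : S →+* T) (e u : ℕ → S) (n : ℕ) :
    f (hConv e u n) = hConv (fun k => f (e k)) (fun k => f (u k)) n := by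
  simp [hConv, map_hSeq]

/-- The elementary symmetric polynomials with the variable `x` removed. -/
def eDel (e : ℕ → S) (x : S) : ℕ → S
  | 0 => 1
  | k + 1 => e (k + 1) - x * eDel e x k

lemma mul_eDel (e : ℕ → S) (x : S) (k : ℕ) :
    x * eDel e x k = e (k + 1) - eDel e x (k + 1) := by rw [eDel]; ring

/-- `∑ x_i e_k e_l`, with the variable `x_i` removed from `e_k` and `e_l`. -/
def eDelPair {ι : Type*} [Fintype ι] (e : ℕ → S) (x : ι → S) (k l : ℕ) : S :=
  ∑ i, x i * eDel e (x i) k * eDel e (x i) l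

lemma eDelPair_comm {ι : Type*} [Fintype ι] (e : ℕ → S) (x : ι → S) (k l : ℕ) :
    eDelPair e x k l = eDelPair e x l k :=
  sum_congr rfl fun _ _ => by ring

/-- The expansion of `eDelPair` for `l ≤ k`, as a polynomial in the `e_k`. -/
def eDelPairFormula (e : ℕ → S) : ℕ → ℕ → S
  | k, 0 => ((k : S) + 1) * e (k + 1)
  | k, l + 1 => ((k - l : ℕ) : S) * (e (k + 1) * e (l + 1)) + eDelPairFormula e (k + 1) l

lemma map_eDelPairFormula {T : Type*} [CommRing T] (f : S →+* T) (e : ℕ → S) (k l : ℕ) :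
    f (eDelPairFormula e k l) = eDelPairFormula (fun k => f (e k)) k l := by
  induction l generalizing k with
  | zero => simp [eDelPairFormula]
  | succ l ih => simp [eDelPairFormula, ih]

section Family

variable {ι : Type*} [Fintype ι] {e : ℕ → S} {x : ι → S}
  (he : ∀ k, ∑ i, x i * eDel e (x i) k = ((k : S) + 1) * e (k + 1))

include he

lemma eDelPair_eq (k l : ℕ) (hlk : l ≤ k) : eDelPair e x k l = eDelPairFormula e k l := by
  induction l generalizing k with
  | zero => simpa [eDelPair, eDelPairFormula, eDel] using he k
  | succ l ih =>
    have h1 : eDelPair e x k (l + 1) - eDelPair e x (k + 1) l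
        = e (l + 1) * ∑ i, x i * eDel e (x i) k - e (k + 1) * ∑ i, x i * eDel e (x i) l := by
      simp only [eDelPair, mul_sum, ← sum_sub_distrib, eDel]
      exact sum_congr rfl fun _ _ => by ring
    rw [eDelPairFormula, ← ih (k + 1) (by omega), ← sub_eq_iff_eq_add, h1, he, he,
      Nat.cast_sub (by omega)]
    ring

end Family

section Transfer

variable {ι : Type*} [Fintype ι]

/-- The transfer matrix of proper colourings: entry `(i, j)` enumerates the proper colourings of
a path with `m` internal vertices and end colours `i` and `j`, weighted by the internal
vertices. -/
noncomputable def pathMat (x : ι → S) (m : ℕ) : Matrix ι ι S :=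
  (Matrix.of fun i j => if i = j then 0 else 1) *
    (Matrix.diagonal x * Matrix.of fun i j => if i = j then 0 else 1) ^ m

lemma pathMat_zero (x : ι → S) (i j : ι) : pathMat x 0 i j = if i = j then 0 else 1 := by
  simp [pathMat]

lemma pathMat_add (x : ι → S) (m r : ℕ) :
    pathMat x (m + r + 1) = pathMat x m * Matrix.diagonal x * pathMat x r := by
  simp only [pathMat, Matrix.mul_assoc]
  rw [← Matrix.mul_assoc (Matrix.diagonal x), ← pow_succ', ← pow_add]
  congr 2

lemma pathMat_add_apply (x : ι → S) (m r : ℕ) (i j : ι) :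
    pathMat x (m + r + 1) i j = ∑ k, pathMat x m i k * x k * pathMat x r k j := by
  rw [pathMat_add, Matrix.mul_apply]
  simp [Matrix.mul_diagonal]

lemma sum_ite_eq_zero_mul (f : ι → S) (i : ι) :
    ∑ k, (if i = k then 0 else 1) * f k = ∑ k, f k - f i := by
  have : ∀ k, (if i = k then 0 else 1) * f k = f k - if i = k then f k else 0 := by
    intro k; split_ifs <;> simp
  simp only [this, sum_sub_distrib, sum_ite_eq, mem_univ, if_true]

lemma pathMat_succ (x : ι → S) (m : ℕ) (i j : ι) :
    pathMat x (m + 1) i j = ∑ k, x k * pathMat x m k j - x i * pathMat x m i j := by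
  have h := pathMat_add_apply x 0 m i j
  rw [zero_add] at h
  simp only [h, pathMat_zero, mul_assoc]
  exact sum_ite_eq_zero_mul _ i

lemma pathMat_symm (x : ι → S) (m : ℕ) (i j : ι) : pathMat x m i j = pathMat x m j i := by
  induction m generalizing i j with
  | zero => simp [pathMat_zero, eq_comm]
  | succ m ih =>
    have h := pathMat_add_apply x m 0 j i
    have h' := pathMat_add_apply x 0 m i j
    rw [zero_add] at h'
    rw [h', h]
    refine sum_congr rfl fun k _ => ?_
    rw [ih k j, pathMat_zero, pathMat_zero, if_congr (eq_comm (a := i) (b := k)) rfl rfl]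
    ring

variable {e : ℕ → S} {x : ι → S}
  (he : ∀ k, ∑ i, x i * eDel e (x i) k = ((k : S) + 1) * e (k + 1))

include he

lemma sub_hConv_eDel (m : ℕ) (j : ι) :
    ∑ i, x i * hConv e (eDel e (x i)) m - x j * hConv e (eDel e (x j)) m
      = hConv e (eDel e (x j)) (m + 1) := by
  rw [hConv_succ, hSeq_succ, eDel, one_mul, hConv_add, mul_hConv]
  simp only [mul_hConv, sum_hConv, he, hConv_sub]
  congr 1
  funext k
  rw [mul_eDel]
  ring

lemma sum_mul_pathMat (m : ℕ) (j : ι) :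
    ∑ i, x i * pathMat x m i j = hConv e (eDel e (x j)) (m + 1) := by
  induction m generalizing j with
  | zero =>
    have h := sub_hConv_eDel he 0 j
    simp only [hConv_zero, eDel, mul_one] at h
    rw [← h, ← sum_ite_eq_zero_mul x j]
    refine sum_congr rfl fun i _ => ?_
    rw [pathMat_zero, mul_comm, if_congr (eq_comm (a := i) (b := j)) rfl rfl]
  | succ m ih =>
    rw [← sub_hConv_eDel he (m + 1) j]
    simp only [← ih]
    have h : ∀ i, pathMat x (m + 1) i j = ∑ k, x k * pathMat x m k i - x j * pathMat x m j i := by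
      intro i
      rw [pathMat_symm, pathMat_succ]
    simp only [h, mul_sub, sum_sub_distrib]
    congr 1
    rw [mul_sum]
    refine sum_congr rfl fun i _ => ?_
    rw [pathMat_symm]
    ring

lemma pathMat_diag (m : ℕ) (i : ι) :
    pathMat x m i i = hConv e (fun k => (k : S) * eDel e (x i) k) m := by
  induction m with
  | zero => simp [pathMat_zero, hConv_zero]
  | succ m ih =>
    rw [pathMat_succ, sum_mul_pathMat he, ih, hConv_succ, hConv_succ, hSeq_succ, eDel, one_mul,
      mul_hConv, hConv_add, hConv_sub, Nat.cast_zero, zero_mul, zero_mul, zero_add]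
    congr 1
    funext k
    push_cast
    linear_combination -(k : S) * mul_eDel e (x i) k

lemma mul_pathMat_diag (m : ℕ) (i : ι) :
    x i * pathMat x m i i = hConv e (fun k => (1 - (k : S)) * eDel e (x i) k) (m + 1) := by
  have h := pathMat_succ x m i i
  rw [sum_mul_pathMat he, pathMat_diag he (m + 1)] at h
  rw [← sub_sub_cancel (hConv e (eDel e (x i)) (m + 1)) (x i * pathMat x m i i), ← h, hConv_sub]
  congr 1
  funext k
  ring

/-- The theta graph with a path of length two, in terms of closed walks. -/
lemma sum_pathMat_one (a b : ℕ) :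
    ∑ i, ∑ j, x i * x j * pathMat x a i j * pathMat x b i j * pathMat x 1 i j
      = e 1 * ∑ i, x i * pathMat x (a + b + 1) i i
        - 2 * ∑ i, x i * (x i * pathMat x (a + b + 1) i i)
        + ∑ i, x i * (x i * pathMat x a i i) * (x i * pathMat x b i i) := by
  have h1 : ∀ i j, pathMat x 1 i j = e 1 - x j - x i + if i = j then x i else 0 := by
    intro i j
    have h := pathMat_succ x 0 i j
    have h0 := pathMat_succ x 0 j j
    have hs := he 0
    simp only [eDel, mul_one, Nat.cast_zero, zero_add, one_mul] at hs
    have : ∑ k, x k * pathMat x 0 k j = e 1 - x j := by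
      rw [← hs, ← sum_ite_eq_zero_mul x j]
      refine sum_congr rfl fun i _ => ?_
      rw [pathMat_zero, mul_comm, if_congr (eq_comm (a := i) (b := j)) rfl rfl]
    rw [zero_add] at h
    rw [h, this, pathMat_zero]
    split_ifs <;> ring
  have hK : ∀ i, pathMat x (a + b + 1) i i = ∑ j, pathMat x a i j * x j * pathMat x b i j := by
    intro i
    rw [pathMat_add_apply]
    exact sum_congr rfl fun j _ => by rw [pathMat_symm x b]
  have hS : ∑ i, ∑ j, x i * x j * pathMat x a i j * pathMat x b i j * x j
      = ∑ i, ∑ j, x i * x j * pathMat x a i j * pathMat x b i j * x i := by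
    rw [sum_comm]
    refine sum_congr rfl fun i _ => sum_congr rfl fun j _ => ?_
    rw [pathMat_symm x a j i, pathMat_symm x b j i]
    ring
  have hD : ∑ i, ∑ j, x i * x j * pathMat x a i j * pathMat x b i j * (if i = j then x i else 0)
      = ∑ i, x i * (x i * pathMat x a i i) * (x i * pathMat x b i i) := by
    refine sum_congr rfl fun i _ => ?_
    simp only [mul_ite, mul_zero, sum_ite_eq, mem_univ, if_true]
    ring
  simp only [h1, mul_add, mul_sub, sum_add_distrib, sum_sub_distrib, hS, hD]
  simp only [hK, mul_sum]
  have h3 : ∑ i, ∑ j, x i * x j * pathMat x a i j * pathMat x b i j * e 1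
      = ∑ i, ∑ j, e 1 * (x i * (pathMat x a i j * x j * pathMat x b i j)) :=
    sum_congr rfl fun i _ => sum_congr rfl fun j _ => by ring
  have h4 : ∑ i, ∑ j, 2 * (x i * (x i * (pathMat x a i j * x j * pathMat x b i j)))
      = 2 * ∑ i, ∑ j, x i * x j * pathMat x a i j * pathMat x b i j * x i := by
    simp only [mul_sum]
    exact sum_congr rfl fun i _ => sum_congr rfl fun j _ => by ring
  rw [h3, h4]
  ring

lemma sum_mul_pathMat_diag (m : ℕ) :
    ∑ i, x i * pathMat x m i i = hConv e (fun k => (k : S) * (((k : S) + 1) * e (k + 1))) m := by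
  simp only [pathMat_diag he, mul_hConv, sum_hConv]
  congr 1
  funext k
  rw [← he, mul_sum]
  exact sum_congr rfl fun _ _ => by ring

lemma sum_mul_mul_pathMat_diag (m : ℕ) :
    ∑ i, x i * (x i * pathMat x m i i)
      = hConv e (fun k => (1 - (k : S)) * (((k : S) + 1) * e (k + 1))) (m + 1) := by
  simp only [mul_pathMat_diag he, mul_hConv, sum_hConv]
  congr 1
  funext k
  rw [← he, mul_sum]
  exact sum_congr rfl fun _ _ => by ring

lemma sum_mul_pathMat_diag_mul_pathMat_diag (a b : ℕ) :
    ∑ i, x i * (x i * pathMat x a i i) * (x i * pathMat x b i i)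
      = hSeq e (a + 1) * hConv e (fun k => (1 - (k : S)) * (((k : S) + 1) * e (k + 1))) (b + 1)
        + hSeq e (b + 1) * hConv e (fun k => (1 - (k : S)) * (((k : S) + 1) * e (k + 1))) (a + 1)
        - e 1 * hSeq e (a + 1) * hSeq e (b + 1)
        + ∑ k ∈ range (a + 1), ∑ l ∈ range (b + 1),
            (k : S) * (l : S) * eDelPair e x (k + 1) (l + 1) * hSeq e (a - k) * hSeq e (b - l) := by
  have hrow : ∀ c, hConv e (fun k => (1 - (k : S)) * (((k : S) + 1) * e (k + 1))) (c + 1)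
      = e 1 * hSeq e (c + 1) - ∑ k ∈ range (c + 1), (k : S) * eDelPair e x (k + 1) 0
          * hSeq e (c - k) := by
    intro c
    rw [hConv_succ, sub_eq_add_neg (e 1 * _), ← sum_neg_distrib, hConv]
    congr 1
    · simp
    · refine sum_congr rfl fun k _ => ?_
      rw [← he, eDelPair]
      simp only [eDel, mul_one]
      push_cast
      ring
  have hfac : ∀ c i, x i * pathMat x c i i = hSeq e (c + 1)
      - ∑ k ∈ range (c + 1), (k : S) * eDel e (x i) (k + 1) * hSeq e (c - k) := by
    intro c i
    rw [mul_pathMat_diag he, hConv_succ, sub_eq_add_neg (hSeq e _), ← sum_neg_distrib, hConv]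
    congr 1
    · simp [eDel]
    · refine sum_congr rfl fun k _ => ?_
      push_cast
      ring
  have hlin : ∀ c, ∑ i, x i * ∑ k ∈ range (c + 1), (k : S) * eDel e (x i) (k + 1) * hSeq e (c - k)
      = ∑ k ∈ range (c + 1), (k : S) * eDelPair e x (k + 1) 0 * hSeq e (c - k) := by
    intro c
    simp only [mul_sum, eDelPair, sum_mul]
    rw [sum_comm]
    exact sum_congr rfl fun k _ => sum_congr rfl fun i _ => by rw [eDel, eDel]; ring
  have hquad : ∑ i, x i * (∑ k ∈ range (a + 1), (k : S) * eDel e (x i) (k + 1) * hSeq e (a - k))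
        * (∑ l ∈ range (b + 1), (l : S) * eDel e (x i) (l + 1) * hSeq e (b - l))
      = ∑ k ∈ range (a + 1), ∑ l ∈ range (b + 1),
          (k : S) * (l : S) * eDelPair e x (k + 1) (l + 1) * hSeq e (a - k) * hSeq e (b - l) := by
    simp only [eDelPair, mul_sum, sum_mul]
    rw [sum_comm]
    simp only [sum_comm (s := univ)]
    rw [sum_comm]
    refine sum_congr rfl fun k _ => sum_congr rfl fun l _ => sum_congr rfl fun i _ => by ring
  have h1 : ∑ i, x i = e 1 := by simpa [eDel] using he 0
  have hexp : ∀ i, x i * (x i * pathMat x a i i) * (x i * pathMat x b i i)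
      = x i * (hSeq e (a + 1) * hSeq e (b + 1))
        - hSeq e (b + 1) * (x i * ∑ k ∈ range (a + 1),
            (k : S) * eDel e (x i) (k + 1) * hSeq e (a - k))
        - hSeq e (a + 1) * (x i * ∑ k ∈ range (b + 1),
            (k : S) * eDel e (x i) (k + 1) * hSeq e (b - k))
        + x i * (∑ k ∈ range (a + 1), (k : S) * eDel e (x i) (k + 1) * hSeq e (a - k))
          * (∑ l ∈ range (b + 1), (l : S) * eDel e (x i) (l + 1) * hSeq e (b - l)) := by
    intro i
    rw [hfac, hfac]
    ring
  simp only [hexp, sum_add_distrib, sum_sub_distrib, ← sum_mul, ← mul_sum, h1, hlin, hquad, hrow]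
  ring

end Transfer

lemma hConv_one_sub (e : ℕ → S) (n : ℕ) :
    hConv e (fun k => (1 - (k : S)) * (((k : S) + 1) * e (k + 1))) n
      = e 1 * hSeq e n - hConv e (fun k => (((k - 1) * (k + 1) : ℕ) : S) * e (k + 1)) n := by
  rw [eq_sub_iff_add_eq, hConv_add, hConv, sum_range_succ', sum_eq_zero]
  · simp
  · intro k _
    push_cast [Nat.add_sub_cancel]
    ring

/-- The expansion of the chromatic symmetric function of the theta graph with paths of lengths
`a + 1`, `b + 1` and `2` in elementary symmetric functions, given as a sum of five `e`-positive
expressions. -/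
def clockFormula (e : ℕ → S) (a b : ℕ) : S :=
  e 1 * hConv e (fun k => ((k * (k - 1) : ℕ) : S) * e (k + 1)) (a + b + 1)
    + e 1 * (hSeq e (a + 1) * hSeq e (b + 1))
    + (hConv e (fun k => (((k - 1) * (k + 1) : ℕ) : S) * e (k + 1)) (a + 1 + (b + 1))
      - hSeq e (a + 1) * hConv e (fun k => (((k - 1) * (k + 1) : ℕ) : S) * e (k + 1)) (b + 1))
    + (hConv e (fun k => (((k - 1) * (k + 1) : ℕ) : S) * e (k + 1)) (b + 1 + (a + 1))
      - hSeq e (b + 1) * hConv e (fun k => (((k - 1) * (k + 1) : ℕ) : S) * e (k + 1)) (a + 1))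
    + ∑ k ∈ range (a + 1), ∑ l ∈ range (b + 1),
        (k : S) * (l : S) * eDelPairFormula e (max (k + 1) (l + 1)) (min (k + 1) (l + 1))
          * hSeq e (a - k) * hSeq e (b - l)

lemma map_clockFormula {T : Type*} [CommRing T] (f : S →+* T) (e : ℕ → S) (a b : ℕ) :
    f (clockFormula e a b) = clockFormula (fun k => f (e k)) a b := by
  simp only [clockFormula, map_add, map_sub, map_mul, map_sum, map_natCast, map_hConv, map_hSeq,
    map_eDelPairFormula]

lemma sum_pathMat_one_eq_clockFormula {ι : Type*} [Fintype ι] {e : ℕ → S} {x : ι → S}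
    (he : ∀ k, ∑ i, x i * eDel e (x i) k = ((k : S) + 1) * e (k + 1)) (a b : ℕ) :
    ∑ i, ∑ j, x i * x j * pathMat x a i j * pathMat x b i j * pathMat x 1 i j
      = clockFormula e a b := by
  have hB : ∀ k l, eDelPair e x k l = eDelPairFormula e (max k l) (min k l) := by
    intro k l
    rcases le_total k l with h | h
    · rw [max_eq_right h, min_eq_left h, eDelPair_comm, eDelPair_eq he _ _ h]
    · rw [max_eq_left h, min_eq_right h, eDelPair_eq he _ _ h]
  have hK : hConv e (fun k => ((k * (k - 1) : ℕ) : S) * e (k + 1)) (a + b + 1)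
      = hConv e (fun k => (k : S) * (((k : S) + 1) * e (k + 1))) (a + b + 1)
        - 2 * hSeq e (a + b + 1 + 1) := by
    rw [hSeq_succ, mul_hConv, hConv_sub]
    congr 1
    funext k
    cases k
    · simp
    · push_cast [Nat.add_sub_cancel]
      ring
  rw [sum_pathMat_one he, sum_mul_pathMat_diag he, sum_mul_mul_pathMat_diag he,
    sum_mul_pathMat_diag_mul_pathMat_diag he, clockFormula, hK]
  simp only [hB, hConv_one_sub, show a + 1 + (b + 1) = a + b + 1 + 1 by ring,
    show b + 1 + (a + 1) = a + b + 1 + 1 by ring]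
  ring

end Algebra

section Positivity

lemma eDel_eq_sum {S : Type*} [CommRing S] {e : ℕ → S} (h0 : e 0 = 1) (x : S) (k : ℕ) :
    eDel e x k = ∑ p ∈ antidiagonal k, e p.1 * (-x) ^ p.2 := by
  induction k with
  | zero => simp [eDel, h0]
  | succ k ih =>
    rw [eDel, ih, Finset.Nat.antidiagonal_succ', sum_cons, sum_map, mul_sum, sub_eq_add_neg,
      ← sum_neg_distrib]
    congr 1
    · simp
    · refine sum_congr rfl fun p _ => ?_
      simp [pow_succ]
      ring

lemma sum_X_mul_eDel_esymm (N k : ℕ) :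
    ∑ i : Fin N, (X i : MvPolynomial (Fin N) ℝ) * eDel (esymm (Fin N) ℝ) (X i) k
      = ((k : MvPolynomial (Fin N) ℝ) + 1) * esymm (Fin N) ℝ (k + 1) := by
  have h := mul_esymm_eq_sum (Fin N) ℝ (k + 1)
  push_cast at h
  rw [h, sum_filter, Finset.Nat.antidiagonal_succ', sum_cons, sum_map, if_neg (by simp), zero_add,
    mul_sum]
  simp only [eDel_eq_sum (esymm_zero (Fin N) ℝ), mul_sum]
  rw [sum_comm]
  refine sum_congr rfl fun p hp => ?_
  rw [HasAntidiagonal.mem_antidiagonal] at hp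
  rw [if_pos (by simp; omega), ← hp]
  have hs : ((-1 : MvPolynomial (Fin N) ℝ)) ^ (p.1 + p.2 + 1 + 1) * (-1) ^ p.1 = (-1) ^ p.2 := by
    rw [← pow_add, show p.1 + p.2 + 1 + 1 + p.1 = 2 * (p.1 + 1) + p.2 by ring, pow_add, pow_mul]
    simp
  simp only [Function.Embedding.prodMap, Function.Embedding.coeFn_mk, Prod.map,
    Function.Embedding.refl_apply]
  rw [← mul_assoc, ← mul_assoc, hs, psum, mul_sum]
  refine sum_congr rfl fun i _ => ?_
  rw [neg_pow, Nat.succ_eq_add_one]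
  ring

/-- The elementary symmetric polynomials, as families indexed by the number of variables. -/
noncomputable def esymmFam (k : ℕ) : ∀ N, MvPolynomial (Fin N) ℝ := fun N => esymm (Fin N) ℝ k

/-- Nonnegative combinations of products of elementary symmetric polynomials of degree `n`, with
coefficients that do not depend on the number of variables. -/
def EPositive (n : ℕ) (F : ∀ N, MvPolynomial (Fin N) ℝ) : Prop :=
  ∃ c : Nat.Partition n → ℝ, (∀ P, 0 ≤ c P) ∧
    F = ∑ P : Nat.Partition n, c P • (P.parts.map esymmFam).prod

namespace EPositive

variable {m n : ℕ} {F G : ∀ N, MvPolynomial (Fin N) ℝ}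

lemma zero : EPositive n 0 := ⟨0, by simp, by simp⟩

lemma add (hF : EPositive n F) (hG : EPositive n G) : EPositive n (F + G) := by
  obtain ⟨c, hc, rfl⟩ := hF
  obtain ⟨d, hd, rfl⟩ := hG
  exact ⟨c + d, fun P => add_nonneg (hc P) (hd P), by simp [add_smul, sum_add_distrib]⟩

lemma smul (r : ℝ) (hr : 0 ≤ r) (hF : EPositive n F) : EPositive n (r • F) := by
  obtain ⟨c, hc, rfl⟩ := hF
  exact ⟨r • c, fun P => mul_nonneg hr (hc P), by simp [smul_sum, mul_smul]⟩

lemma natCast_mul (r : ℕ) (hF : EPositive n F) :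
    EPositive n ((r : ∀ N, MvPolynomial (Fin N) ℝ) * F) := by
  rw [← nsmul_eq_mul, ← Nat.cast_smul_eq_nsmul ℝ]
  exact hF.smul _ r.cast_nonneg

lemma sum {ι : Type*} (s : Finset ι) {f : ι → ∀ N, MvPolynomial (Fin N) ℝ}
    (h : ∀ i ∈ s, EPositive n (f i)) : EPositive n (∑ i ∈ s, f i) :=
  Finset.sum_induction f (EPositive n) (fun _ _ => add) zero h

lemma prod_parts (P : Nat.Partition n) : EPositive n (P.parts.map esymmFam).prod :=
  ⟨Pi.single P 1, fun Q => by rw [Pi.single_apply]; split_ifs <;> simp,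
    by simp [Pi.single_apply, ite_smul]⟩

lemma mul (hF : EPositive m F) (hG : EPositive n G) : EPositive (m + n) (F * G) := by
  obtain ⟨c, hc, rfl⟩ := hF
  obtain ⟨d, hd, rfl⟩ := hG
  rw [sum_mul_sum]
  refine sum _ fun P _ => sum _ fun Q _ => ?_
  rw [smul_mul_smul_comm]
  refine smul _ (mul_nonneg (hc P) (hd Q)) ?_
  rw [← Multiset.prod_add, ← Multiset.map_add]
  exact prod_parts ⟨P.parts + Q.parts,
    fun hi => (Multiset.mem_add.1 hi).elim P.parts_pos Q.parts_pos, by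
      rw [Multiset.sum_add, P.parts_sum, Q.parts_sum]⟩

lemma one : EPositive 0 1 := by
  simpa using prod_parts (⟨0, by simp, by simp⟩ : Nat.Partition 0)

lemma esymmFam_succ (k : ℕ) : EPositive (k + 1) (esymmFam (k + 1)) := by
  simpa using prod_parts (⟨{k + 1}, by simp, by simp⟩ : Nat.Partition (k + 1))

lemma of_eq (h : EPositive m F) (hmn : m = n) : EPositive n F := hmn ▸ h

lemma hConv_of_hSeq (u : ℕ → ℕ) (hh : ∀ k ≤ n, EPositive k (hSeq esymmFam k)) :
    EPositive (n + 1)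
      (hConv esymmFam
        (fun k => (u k : ∀ N, MvPolynomial (Fin N) ℝ) * esymmFam (k + 1)) n) := by
  refine sum _ fun k hk => ?_
  rw [mem_range] at hk
  exact (((esymmFam_succ k).natCast_mul (u k)).mul (hh _ (Nat.sub_le n k))).of_eq (by omega)

lemma hSeq_esymmFam (n : ℕ) : EPositive n (hSeq esymmFam n) := by
  induction n using Nat.strong_induction_on with
  | _ n ih =>
    cases n with
    | zero => rw [hSeq_zero]; exact one
    | succ n =>
      rw [hSeq_succ]
      exact hConv_of_hSeq (fun k => k) fun k hk => ih k (by omega)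

lemma hConv_esymmFam (u : ℕ → ℕ) (n : ℕ) :
    EPositive (n + 1)
      (hConv esymmFam
        (fun k => (u k : ∀ N, MvPolynomial (Fin N) ℝ) * esymmFam (k + 1)) n) :=
  hConv_of_hSeq u fun k _ => hSeq_esymmFam k

/-- Concatenation: `h_a` times a convolution of degree `c` is dominated by the convolution of
degree `a + c`, provided this holds for `hSeq` itself. -/
lemma hConv_sub_of_hSeq (u : ℕ → ℕ) (a c : ℕ)
    (hh : ∀ k ≤ c, EPositive (a + k)
      (hSeq esymmFam (a + k)
        - hSeq esymmFam a * hSeq esymmFam k)) :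
    EPositive (a + c + 1)
      (hConv esymmFam
          (fun k => (u k : ∀ N, MvPolynomial (Fin N) ℝ) * esymmFam (k + 1)) (a + c)
        - hSeq esymmFam a * hConv esymmFam
          (fun k => (u k : ∀ N, MvPolynomial (Fin N) ℝ) * esymmFam (k + 1)) c) := by
  rw [hConv, hConv, show a + c + 1 = c + 1 + a by ring, sum_range_add, add_sub_right_comm,
    mul_sum, ← sum_sub_distrib]
  refine add (sum _ fun k hk => ?_) (sum _ fun k hk => ?_)
  · rw [mem_range] at hk
    have h := ((esymmFam_succ k).natCast_mul (u k)).mul (hh (c - k) (by omega))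
    rw [← Nat.add_sub_assoc (by omega)] at h
    have h' := h.of_eq (show _ = c + 1 + a by omega)
    convert h' using 1
    ring
  · rw [mem_range] at hk
    exact (((esymmFam_succ _).natCast_mul _).mul (hSeq_esymmFam _)).of_eq (by omega)

lemma hSeq_sub (a c : ℕ) :
    EPositive (a + c) (hSeq esymmFam (a + c)
      - hSeq esymmFam a * hSeq esymmFam c) := by
  induction c using Nat.strong_induction_on with
  | _ c ih =>
    cases c with
    | zero => simpa [hSeq_zero] using zero
    | succ c =>
      rw [← add_assoc, hSeq_succ, hSeq_succ _ c]
      exact hConv_sub_of_hSeq (fun k => k) a c fun k hk => ih k (by omega)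

lemma hConv_sub (u : ℕ → ℕ) (a c : ℕ) :
    EPositive (a + c + 1)
      (hConv esymmFam
          (fun k => (u k : ∀ N, MvPolynomial (Fin N) ℝ) * esymmFam (k + 1)) (a + c)
        - hSeq esymmFam a * hConv esymmFam
          (fun k => (u k : ∀ N, MvPolynomial (Fin N) ℝ) * esymmFam (k + 1)) c) :=
  hConv_sub_of_hSeq u a c fun k _ => hSeq_sub a k

lemma eDelPairFormula_esymmFam (k l : ℕ) :
    EPositive (k + l + 1) (eDelPairFormula esymmFam k l) := by
  induction l generalizing k with
  | zero =>
    rw [eDelPairFormula, ← Nat.cast_add_one]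
    exact (esymmFam_succ k).natCast_mul _
  | succ l ih =>
    rw [eDelPairFormula]
    exact (natCast_mul _ (((esymmFam_succ k).mul (esymmFam_succ l)).of_eq (by omega))).add
      ((ih (k + 1)).of_eq (by omega))

lemma clockFormula_esymmFam (a b : ℕ) :
    EPositive (a + b + 3) (clockFormula esymmFam a b) := by
  refine add (add (add (add ?_ ?_) ?_) ?_) ?_
  · exact ((esymmFam_succ 0).mul (hConv_esymmFam _ _)).of_eq (by omega)
  · exact ((esymmFam_succ 0).mul ((hSeq_esymmFam _).mul (hSeq_esymmFam _))).of_eq (by omega)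
  · exact (hConv_sub _ _ _).of_eq (by omega)
  · exact (hConv_sub _ _ _).of_eq (by omega)
  · refine sum _ fun k hk => sum _ fun l hl => ?_
    rw [mem_range] at hk hl
    rw [← Nat.cast_mul]
    exact ((((eDelPairFormula_esymmFam _ _).natCast_mul _).mul (hSeq_esymmFam _)).mul
      (hSeq_esymmFam _)).of_eq (by omega)

end EPositive

end Positivity

section Theta

lemma forall_mem_chainE {R : ℕ → ℕ → Prop} (l : List ℕ) :
    (∀ p ∈ chainE l, R p.1 p.2) ↔ l.IsChain R := by
  induction l with
  | nil => simp [chainE]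
  | cons u t ih =>
    cases t with
    | nil => simp [chainE]
    | cons v t =>
      rw [List.isChain_cons_cons, ← ih]
      simp [chainE]

lemma graphOfEdges_proper_iff {ι : Type*} {n : ℕ} {E : List (ℕ × ℕ)}
    (hlt : ∀ p ∈ E, p.1 < n ∧ p.2 < n) (hne : ∀ p ∈ E, p.1 ≠ p.2)
    (κ : Fin n → ι) (K : ℕ → ι) (hK : ∀ v : Fin n, K v = κ v) :
    (∀ u v, (graphOfEdges n E).Adj u v → κ u ≠ κ v) ↔ ∀ p ∈ E, K p.1 ≠ K p.2 := by
  constructor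
  · intro h p hp
    have := h ⟨p.1, (hlt p hp).1⟩ ⟨p.2, (hlt p hp).2⟩
      ((SimpleGraph.fromRel_adj _ _ _).2 ⟨fun h' => hne p hp (congrArg Fin.val h'), Or.inl hp⟩)
    rwa [← hK, ← hK] at this
  · intro h u v huv
    rw [← hK, ← hK]
    rcases ((SimpleGraph.fromRel_adj _ _ _).1 huv).2 with hp | hp
    · exact h _ hp
    · exact (h _ hp).symm

lemma sum_sumArrow {α β ι M : Type*} [Fintype α] [Fintype β] [Fintype ι] [DecidableEq α]
    [DecidableEq β] [AddCommMonoid M] (F : (α ⊕ β → ι) → M) :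
    ∑ f, F f = ∑ g : α → ι, ∑ h : β → ι, F (Sum.elim g h) := by
  rw [← (Equiv.sumArrowEquivProdArrow α β ι).symm.sum_comp, Fintype.sum_prod_type]
  rfl

lemma sum_unitArrow {ι M : Type*} [Fintype ι] [AddCommMonoid M] (F : (Unit → ι) → M) :
    ∑ f, F f = ∑ i, F fun _ => i := by
  rw [← (Equiv.funUnique Unit ι).symm.sum_comp]
  rfl

lemma csf_eq_of_equiv {V W : Type} [Fintype V] [Fintype W] [DecidableEq W] (e : W ≃ V)
    (G : SimpleGraph V) (N : ℕ) :
    csf G N = ∑ F : W → Fin N,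
      if ∀ u v, G.Adj u v → F (e.symm u) ≠ F (e.symm v) then ∏ w, X (F w) else 0 := by
  rw [csf, ← (Equiv.arrowCongr e (Equiv.refl (Fin N))).sum_comp]
  refine sum_congr rfl fun F _ => ?_
  rw [← e.prod_comp]
  simp

lemma pathMat_eq_sum {S ι : Type*} [CommRing S] [Fintype ι] (x : ι → S) (m : ℕ) (i j : ι) :
    pathMat x m i j = ∑ f : Fin m → ι,
      if (i :: (List.ofFn f ++ [j])).IsChain (· ≠ ·) then ∏ k, x (f k) else 0 := by
  induction m generalizing i with
  | zero => simp [pathMat_zero, ite_not]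
  | succ m ih =>
    have h := pathMat_add_apply x 0 m i j
    rw [zero_add] at h
    rw [h, ← (Fin.consEquiv fun _ => ι).sum_comp, Fintype.sum_prod_type]
    refine sum_congr rfl fun k _ => ?_
    rw [ih, pathMat_zero, mul_sum]
    refine sum_congr rfl fun f _ => ?_
    simp only [Fin.consEquiv_apply, Fin.prod_univ_succ, Fin.cons_zero, Fin.cons_succ]
    by_cases hik : i = k <;> simp [hik]

/-- The vertices of a theta graph: its two hubs and the internal vertices of its paths. -/
def thetaVertex (a b c : ℕ) :
    Unit ⊕ Unit ⊕ Fin a ⊕ Fin b ⊕ Fin c → Fin (a + 1 + (b + 1) + (c + 1) - 1)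
  | .inl _ => ⟨0, by omega⟩
  | .inr (.inl _) => ⟨a + 1 + (b + 1) + (c + 1) - 2, by omega⟩
  | .inr (.inr (.inl v)) => ⟨v + 1, by omega⟩
  | .inr (.inr (.inr (.inl v))) => ⟨v + (a + 1), by omega⟩
  | .inr (.inr (.inr (.inr v))) => ⟨v + (a + 1 + (b + 1) - 1), by omega⟩

lemma thetaVertex_bijective (a b c : ℕ) : Function.Bijective (thetaVertex a b c) := by
  rw [Fintype.bijective_iff_injective_and_card]
  constructor
  · rintro (u | u | u | u | u) (v | v | v | v | v) h <;>
      simp only [thetaVertex, Fin.mk.injEq] at h <;>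
      first
        | rfl
        | omega
        | (have := Fin.ext (a := u) (b := v) (by omega); rw [this])
  · simp only [Fintype.card_sum, Fintype.card_unit, Fintype.card_fin]
    omega

lemma isChain_map_path {ι : Type*} (K : ℕ → ι) (m s t : ℕ) (f : Fin m → ι)
    (hf : ∀ v : Fin m, K (v + s) = f v) :
    (chainE (0 :: ((List.range m).map (· + s) ++ [t]))).Forall (fun p => K p.1 ≠ K p.2)
      ↔ (K 0 :: (List.ofFn f ++ [K t])).IsChain (· ≠ ·) := by
  have h : K 0 :: (List.ofFn f ++ [K t])
      = (0 :: ((List.range m).map (· + s) ++ [t])).map K := by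
    have : List.ofFn f = ((List.range m).map (· + s)).map K :=
      List.ext_getElem (by simp) fun k h1 _ => by
        simpa using (hf ⟨k, by simpa using h1⟩).symm
    simp [this]
  rw [h, List.isChain_map, ← forall_mem_chainE, List.forall_iff_forall_mem]

lemma chainE_path_lt {m s t n : ℕ} (hm : m + s ≤ n) (ht : t < n) :
    ∀ p ∈ chainE (0 :: ((List.range m).map (· + s) ++ [t])), p.1 < n ∧ p.2 < n := by
  intro p hp
  have h : ∀ v ∈ 0 :: ((List.range m).map (· + s) ++ [t]), v < n := by
    simp only [List.mem_cons, List.mem_append, List.mem_map, List.mem_range, List.not_mem_nil,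
      or_false]
    rintro v (rfl | ⟨w, hw, rfl⟩ | rfl) <;> omega
  have hp' := List.of_mem_zip hp
  exact ⟨h _ hp'.1, h _ (List.mem_of_mem_tail hp'.2)⟩

lemma chainE_path_ne {m s t : ℕ} (hs : 0 < s) (ht : m + s ≤ t) :
    ∀ p ∈ chainE (0 :: ((List.range m).map (· + s) ++ [t])), p.1 ≠ p.2 := by
  rw [forall_mem_chainE (R := (· ≠ ·))]
  apply List.Pairwise.isChain
  simp only [List.pairwise_cons, List.pairwise_append, List.pairwise_map, List.mem_append,
    List.mem_map, List.mem_range, List.mem_singleton]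
  refine ⟨?_, ?_, by simp, ?_⟩
  · rintro v (⟨w, hw, rfl⟩ | rfl) <;> omega
  · exact List.nodup_range.imp fun h => by omega
  · rintro v ⟨w, hw, rfl⟩ u rfl
    omega

lemma csf_thetaG (a b c N : ℕ) :
    csf (thetaG (a + 1) (b + 1) (c + 1)) N
      = ∑ i, ∑ j, X i * X j * pathMat X a i j * pathMat X b i j * pathMat X c i j := by
  set e := Equiv.ofBijective _ (thetaVertex_bijective a b c)
  rw [csf_eq_of_equiv e, sum_sumArrow, sum_unitArrow]
  refine sum_congr rfl fun i _ => ?_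
  rw [sum_sumArrow, sum_unitArrow]
  refine sum_congr rfl fun j _ => ?_
  rw [sum_sumArrow, mul_assoc, mul_assoc, pathMat_eq_sum X a, sum_mul, mul_sum]
  refine sum_congr rfl fun f _ => ?_
  rw [sum_sumArrow, pathMat_eq_sum X b, sum_mul, mul_sum, mul_sum]
  refine sum_congr rfl fun g _ => ?_
  rw [pathMat_eq_sum X c, mul_sum, mul_sum, mul_sum]
  refine sum_congr rfl fun h _ => ?_
  set F : Unit ⊕ Unit ⊕ Fin a ⊕ Fin b ⊕ Fin c → Fin N :=
    Sum.elim (fun _ => i) (Sum.elim (fun _ => j) (Sum.elim f (Sum.elim g h))) with hF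
  set κ : _ → Fin N := fun v => F (e.symm v) with hκ
  have hκe : ∀ y, κ (thetaVertex a b c y) = F y := by
    intro y
    have : thetaVertex a b c y = e y := rfl
    simp [hκ, this]
  have hprod : ∏ w, (X (F w) : MvPolynomial (Fin N) ℝ)
      = X i * X j * (∏ v, X (f v)) * (∏ v, X (g v)) * ∏ v, X (h v) := by
    simp [hF, Fintype.prod_sum_type, mul_assoc]
  set K : ℕ → Fin N := fun p =>
    if hp : p < a + 1 + (b + 1) + (c + 1) - 1 then κ ⟨p, hp⟩ else i with hKdef
  have hKe : ∀ y, K (thetaVertex a b c y) = F y := by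
    intro y
    rw [← hκe]
    simp [hKdef]
  have hK0 : K 0 = i := hKe (.inl ())
  have hKt : K (a + 1 + (b + 1) + (c + 1) - 2) = j := hKe (.inr (.inl ()))
  have hproper : (∀ u v, (thetaG (a + 1) (b + 1) (c + 1)).Adj u v → κ u ≠ κ v) ↔
      ((i :: (List.ofFn f ++ [j])).IsChain (· ≠ ·) ∧ (i :: (List.ofFn g ++ [j])).IsChain (· ≠ ·))
        ∧ (i :: (List.ofFn h ++ [j])).IsChain (· ≠ ·) := by
    rw [thetaG, graphOfEdges_proper_iff _ _ κ K fun v => by simp [hKdef]]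
    · rw [← List.forall_iff_forall_mem, List.forall_append, List.forall_append]
      simp only [Nat.add_sub_cancel a 1, Nat.add_sub_cancel b 1, Nat.add_sub_cancel c 1]
      rw [isChain_map_path K a 1 _ f fun v => hKe (.inr (.inr (.inl v))),
        isChain_map_path K b (a + 1) _ g fun v => hKe (.inr (.inr (.inr (.inl v)))),
        isChain_map_path K c _ _ h fun v => hKe (.inr (.inr (.inr (.inr v)))), hK0, hKt]
    · intro p hp
      rw [List.mem_append, List.mem_append] at hp
      rcases hp with (hp | hp) | hp <;> exact chainE_path_lt (by omega) (by omega) p hp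
    · intro p hp
      rw [List.mem_append, List.mem_append] at hp
      rcases hp with (hp | hp) | hp <;> exact chainE_path_ne (by omega) (by omega) p hp
  simp only [hκ] at hproper
  simp only [hprod, hproper, ite_and]
  split_ifs <;> simp [mul_assoc]

end Theta

/-- All clock graphs `θ_{ab2}` with `a ≥ b ≥ 2` are `e`-positive. -/
theorem stmt17 (a b : ℕ) (h2 : 2 ≤ b) (hba : b ≤ a) :
    ∃ c : Nat.Partition (a + b + 1) → ℝ, (∀ P, 0 ≤ c P) ∧
      ∀ N, csf (thetaG a b 2) N
        = ∑ P : Nat.Partition (a + b + 1),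
            MvPolynomial.C (c P)
              * (P.parts.map fun i => MvPolynomial.esymm (Fin N) ℝ i).prod := by
  obtain ⟨a, rfl⟩ : ∃ a', a = a' + 1 := ⟨a - 1, by omega⟩
  obtain ⟨b, rfl⟩ : ∃ b', b = b' + 1 := ⟨b - 1, by omega⟩
  obtain ⟨c, hc, h⟩ :=
    (EPositive.clockFormula_esymmFam a b).of_eq (show _ = a + 1 + (b + 1) + 1 by omega)
  refine ⟨c, hc, fun N => ?_⟩
  have hN : clockFormula (esymm (Fin N) ℝ) a b = clockFormula esymmFam a b N :=
    (map_clockFormula (Pi.evalRingHom (fun N => MvPolynomial (Fin N) ℝ) N) esymmFam a b).symm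
  rw [csf_thetaG a b 1, sum_pathMat_one_eq_clockFormula (sum_X_mul_eDel_esymm N), hN, h,
    Finset.sum_apply]
  refine sum_congr rfl fun P _ => ?_
  rw [Pi.smul_apply, MvPolynomial.smul_eq_C_mul, Pi.multiset_prod_apply, Multiset.map_map]
  rfl
end
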